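/- arXiv:0801.2486 — 3 statements merged into one kernel-verified Lean document; each statement's English description precedes it below -/
import Mathlib

section
/- Let X and Z be real Banach spaces with X separable. Let F be a closed convex subset of X containing 0 whose closed linear span is all of X. Let j : F → Z be a distance-preserving map with j(0) = 0, and suppose there exists a bounded linear operator Q : Z → X with operator norm ‖Q‖ ≤ 1 such that Q(j(x)) = x for every x ∈ F. Then there exists a linear isometric embedding of X into Z. -/
open MeasureTheory Set Function Filter Topology

section DirectionalIntegrals

variable {Z : Type*} [NormedAddCommGroup Z] [NormedSpace ℝ Z] [CompleteSpace Z]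

lemma norm_integral_sub_smul_le {w : ℝ → Z} {L : ℝ} (hw : Continuous w)
    (hL : ∀ x y, ‖w x - w y‖ ≤ L * |x - y|) (b δ : ℝ) :
    ‖(∫ s in b..b + δ, w s) - δ • w b‖ ≤ L * δ ^ 2 := by
  have hL0 : 0 ≤ L := by simpa using (norm_nonneg _).trans (hL 1 0)
  have h1 : (∫ s in b..b + δ, w s) - δ • w b = ∫ s in b..b + δ, (w s - w b) := by
    rw [intervalIntegral.integral_sub (hw.intervalIntegrable _ _) (by simp),
      intervalIntegral.integral_const, add_sub_cancel_left]
  rw [h1]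
  have h2 : ∀ x ∈ uIoc b (b + δ), ‖w x - w b‖ ≤ L * |δ| := by
    intro x hx
    refine (hL x b).trans (mul_le_mul_of_nonneg_left ?_ hL0)
    simpa using abs_sub_left_of_mem_uIcc (uIoc_subset_uIcc hx)
  refine (intervalIntegral.norm_integral_le_of_norm_le_const h2).trans (le_of_eq ?_)
  rw [add_sub_cancel_left, mul_assoc, ← sq, sq_abs]

lemma norm_integral_translate_sub_le {w : ℝ → Z} {L : ℝ} (hw : Continuous w)
    (hL : ∀ x y, ‖w x - w y‖ ≤ L * |x - y|) (a b δ : ℝ) :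
    ‖(∫ s in a..b, (w (s + δ) - w s)) - δ • (w b - w a)‖ ≤ 2 * L * δ ^ 2 := by
  have h1 : (∫ s in a..b, (w (s + δ) - w s))
      = (∫ s in b..b + δ, w s) - ∫ s in a..a + δ, w s := by
    have hwδ : Continuous fun s => w (s + δ) := hw.comp (continuous_id.add continuous_const)
    rw [intervalIntegral.integral_sub (hwδ.intervalIntegrable _ _)
      (hw.intervalIntegrable _ _), intervalIntegral.integral_comp_add_right (fun s => w s),
      intervalIntegral.integral_interval_sub_interval_comm' (hw.intervalIntegrable _ _)
      (hw.intervalIntegrable _ _) (hw.intervalIntegrable _ _)]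
  have h2 : (∫ s in a..b, (w (s + δ) - w s)) - δ • (w b - w a)
      = ((∫ s in b..b + δ, w s) - δ • w b) - ((∫ s in a..a + δ, w s) - δ • w a) := by
    rw [h1, smul_sub]; abel
  rw [h2]
  refine (norm_sub_le _ _).trans ?_
  linarith [norm_integral_sub_smul_le hw hL b δ, norm_integral_sub_smul_le hw hL a δ]

end DirectionalIntegrals

section Cube

/-- The uniform distribution on the interval `[1, 2]`. -/
noncomputable def uniformOneTwo : Measure ℝ := volume.restrict (Ioc 1 2)

instance : IsProbabilityMeasure uniformOneTwo :=
  ⟨by rw [uniformOneTwo, Measure.restrict_apply_univ, Real.volume_Ioc]; norm_num⟩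

/-- The product of countably many copies of the uniform distribution on `[1, 2]`. -/
noncomputable def uniformCube : Measure (ℕ → ℝ) := Measure.infinitePi fun _ => uniformOneTwo

instance : IsProbabilityMeasure uniformCube :=
  inferInstanceAs (IsProbabilityMeasure (Measure.infinitePi _))

lemma ae_uniformCube_mem_Icc : ∀ᵐ t ∂uniformCube, ∀ n, t n ∈ Icc (1 : ℝ) 2 := by
  rw [ae_all_iff]
  intro n
  have h : ∀ᵐ s ∂uniformOneTwo, s ∈ Icc (1 : ℝ) 2 :=
    (ae_restrict_mem measurableSet_Ioc).mono fun s hs => Ioc_subset_Icc_self hs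
  exact (measurePreserving_eval_infinitePi
    (fun _ : ℕ => uniformOneTwo) n).quasiMeasurePreserving.ae h

lemma continuous_update_prod (n : ℕ) :
    Continuous fun p : (ℕ → ℝ) × ℝ => update p.1 n p.2 :=
  continuous_fst.update n continuous_snd

lemma map_update_uniformCube (n : ℕ) :
    (uniformCube.prod uniformOneTwo).map (fun p : (ℕ → ℝ) × ℝ => update p.1 n p.2)
      = uniformCube := by
  refine Measure.eq_infinitePi _ fun s T hT => ?_
  rw [Measure.map_apply (continuous_update_prod n).measurable
    (MeasurableSet.pi s.countable_toSet fun i _ => hT i)]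
  by_cases hn : n ∈ s
  · have h : (fun p : (ℕ → ℝ) × ℝ => update p.1 n p.2) ⁻¹' (Set.pi s T)
        = (Set.pi (s.erase n : Finset ℕ) T) ×ˢ T n := by
      ext ⟨t, x⟩
      simp only [mem_preimage, Set.mem_pi, mem_prod, Finset.mem_coe, Finset.mem_erase]
      constructor
      · intro H
        exact ⟨fun i hi => by simpa [hi.1] using H i hi.2, by simpa using H n hn⟩
      · rintro ⟨H, hx⟩ i hi
        by_cases hin : i = n
        · subst hin; simpa using hx
        · simpa [hin] using H i ⟨hin, hi⟩
    rw [h, Measure.prod_prod, uniformCube, Measure.infinitePi_pi _ fun i _ => hT i,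
      Finset.prod_erase_mul _ _ hn]
  · have h : (fun p : (ℕ → ℝ) × ℝ => update p.1 n p.2) ⁻¹' (Set.pi s T)
        = (Set.pi s T) ×ˢ univ := by
      ext ⟨t, x⟩
      simp only [mem_preimage, Set.mem_pi, mem_prod, Finset.mem_coe, mem_univ, and_true]
      refine forall₂_congr fun i hi => ?_
      rw [update_of_ne (ne_of_mem_of_not_mem hi hn)]
    rw [h, Measure.prod_prod, uniformCube, Measure.infinitePi_pi _ fun i _ => hT i,
      measure_univ, mul_one]

variable {Z : Type*} [NormedAddCommGroup Z] [NormedSpace ℝ Z]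

omit [NormedSpace ℝ Z] in
lemma integrable_of_continuous_of_bounded {α : Type*} [TopologicalSpace α]
    [SecondCountableTopology α] [MeasurableSpace α] [OpensMeasurableSpace α]
    {μ : Measure α} [IsFiniteMeasure μ] {f : α → Z} (hf : Continuous f) {M : ℝ}
    (hM : ∀ x, ‖f x‖ ≤ M) : Integrable f μ :=
  Integrable.of_bound hf.aestronglyMeasurable M (Eventually.of_forall hM)

lemma integral_uniformCube_update {f : (ℕ → ℝ) → Z} (hf : Continuous f) {M : ℝ}
    (hM : ∀ t, ‖f t‖ ≤ M) (n : ℕ) :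
    ∫ t, f t ∂uniformCube = ∫ t, (∫ s in (1 : ℝ)..2, f (update t n s)) ∂uniformCube := by
  conv_lhs => rw [← map_update_uniformCube n]
  rw [integral_map (continuous_update_prod n).measurable.aemeasurable hf.aestronglyMeasurable,
    integral_prod (fun p : (ℕ → ℝ) × ℝ => f (update p.1 n p.2))
      (integrable_of_continuous_of_bounded (hf.comp (continuous_update_prod n)) fun p => hM _)]
  simp only [uniformOneTwo, intervalIntegral.integral_of_le (one_le_two : (1 : ℝ) ≤ 2)]

/-- Translation of the first `N` coordinates of `t` by `h • a`. -/
def shiftInit (a : ℕ → ℝ) (h : ℝ) (N : ℕ) (t : ℕ → ℝ) : ℕ → ℝ :=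
  fun n => t n + if n < N then h * a n else 0

lemma shiftInit_zero (a : ℕ → ℝ) (h : ℝ) (t : ℕ → ℝ) : shiftInit a h 0 t = t := by
  ext n; simp [shiftInit]

lemma shiftInit_update (a : ℕ → ℝ) (h : ℝ) (N : ℕ) (t : ℕ → ℝ) (s : ℝ) :
    shiftInit a h N (update t N s) = update (shiftInit a h N t) N s := by
  ext n
  by_cases hn : n = N
  · subst hn; simp [shiftInit]
  · simp [shiftInit, hn]

lemma shiftInit_succ_update (a : ℕ → ℝ) (h : ℝ) (N : ℕ) (t : ℕ → ℝ) (s : ℝ) :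
    shiftInit a h (N + 1) (update t N s) = update (shiftInit a h N t) N (s + h * a N) := by
  ext n
  by_cases hn : n = N
  · subst hn; simp [shiftInit]
  · have : n < N + 1 ↔ n < N := by omega
    simp [shiftInit, hn, this]

lemma continuous_shiftInit (a : ℕ → ℝ) (h : ℝ) (N : ℕ) : Continuous (shiftInit a h N) :=
  continuous_pi fun n => (continuous_apply n).add continuous_const

omit [NormedSpace ℝ Z] in
lemma norm_comp_shiftInit_sub_le {g : (ℕ → ℝ) → Z} {L : ℕ → ℝ}
    (hL : ∀ t n s s', ‖g (update t n s) - g (update t n s')‖ ≤ L n * |s - s'|)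
    (a : ℕ → ℝ) (h : ℝ) (N : ℕ) (t : ℕ → ℝ) :
    ‖g (shiftInit a h N t) - g t‖ ≤ |h| * ∑ n ∈ Finset.range N, L n * |a n| := by
  induction N with
  | zero => simp [shiftInit_zero]
  | succ N ih =>
    have h1 := shiftInit_succ_update a h N t (t N)
    have h2 := shiftInit_update a h N t (t N)
    rw [update_eq_self] at h1 h2
    have h3 := hL (shiftInit a h N t) N (t N + h * a N) (t N)
    rw [← h1, ← h2, add_sub_cancel_left, abs_mul] at h3
    rw [Finset.sum_range_succ]
    have h4 := norm_sub_le_norm_sub_add_norm_sub (g (shiftInit a h (N + 1) t))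
      (g (shiftInit a h N t)) (g t)
    nlinarith

/-- The mean over the cube of the increment of `g` along the edges in the `n`-th direction. -/
noncomputable def meanIncrement (g : (ℕ → ℝ) → Z) (n : ℕ) : Z :=
  ∫ t, (g (update t n 2) - g (update t n 1)) ∂uniformCube

lemma continuous_update_const (n : ℕ) (s : ℝ) : Continuous fun t : ℕ → ℝ => update t n s :=
  continuous_id.update n continuous_const

lemma exists_norm_integral_shiftInit_sub_le [CompleteSpace Z] {g : (ℕ → ℝ) → Z} {L : ℕ → ℝ} {M : ℝ}
    (hg : Continuous g) (hM : ∀ t, ‖g t‖ ≤ M)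
    (hL : ∀ t n s s', ‖g (update t n s) - g (update t n s')‖ ≤ L n * |s - s'|)
    (a : ℕ → ℝ) (N : ℕ) :
    ∃ C, ∀ h : ℝ, ‖(∫ t, (g (shiftInit a h N t) - g t) ∂uniformCube)
      - h • ∑ n ∈ Finset.range N, a n • meanIncrement g n‖ ≤ C * h ^ 2 := by
  have hM2 : ∀ x y, ‖g x - g y‖ ≤ M + M := fun x y =>
    (norm_sub_le _ _).trans (add_le_add (hM _) (hM _))
  induction N with
  | zero => exact ⟨0, fun h => by simp [shiftInit_zero]⟩
  | succ N ih =>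
    obtain ⟨C, hC⟩ := ih
    set K := ∑ n ∈ Finset.range N, L n * |a n| with hK
    refine ⟨C + (2 * L N * a N ^ 2 + 2 * |a N| * K), fun h => ?_⟩
    have hc := continuous_shiftInit a h N
    have hc' := continuous_shiftInit a h (N + 1)
    have key : ‖(∫ t, (g (shiftInit a h (N + 1) t) - g (shiftInit a h N t)) ∂uniformCube)
        - (h * a N) • meanIncrement g N‖ ≤ (2 * L N * a N ^ 2 + 2 * |a N| * K) * h ^ 2 := by
      have hcd : Continuous fun t => g (shiftInit a h (N + 1) t) - g (shiftInit a h N t) :=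
        (hg.comp hc').sub (hg.comp hc)
      have hcu : Continuous fun t => g (update t N 2) - g (update t N 1) :=
        (hg.comp (continuous_update_const N 2)).sub (hg.comp (continuous_update_const N 1))
      rw [integral_uniformCube_update hcd (fun t => hM2 _ _) N, meanIncrement, ← integral_smul,
        ← integral_sub]
      · refine (norm_integral_le_of_norm_le_const (C := (2 * L N * a N ^ 2 + 2 * |a N| * K) * h ^ 2)
          (Eventually.of_forall fun t => ?_)).trans (by simp)
        simp only [shiftInit_succ_update, shiftInit_update]
        set w : ℝ → Z := fun s => g (update (shiftInit a h N t) N s) with hw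
        have hwc : Continuous w := hg.comp (continuous_const.update N continuous_id)
        have h1 := norm_integral_translate_sub_le hwc (fun x y => hL _ N x y) 1 2 (h * a N)
        have h2 : ∀ s, ‖w s - g (update t N s)‖ ≤ |h| * K := fun s => by
          simpa only [shiftInit_update] using norm_comp_shiftInit_sub_le hL a h N (update t N s)
        have h3 : ‖(h * a N) • ((w 2 - g (update t N 2)) - (w 1 - g (update t N 1)))‖
            ≤ |h * a N| * (|h| * K + |h| * K) := by
          rw [norm_smul, Real.norm_eq_abs]
          exact mul_le_mul_of_nonneg_left
            ((norm_sub_le _ _).trans (add_le_add (h2 2) (h2 1))) (abs_nonneg _)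
        have h4 : (∫ s in (1 : ℝ)..2, (w (s + h * a N) - w s))
              - (h * a N) • (g (update t N 2) - g (update t N 1))
            = ((∫ s in (1 : ℝ)..2, (w (s + h * a N) - w s)) - (h * a N) • (w 2 - w 1))
              + (h * a N) • ((w 2 - g (update t N 2)) - (w 1 - g (update t N 1))) := by
          simp only [smul_sub]; abel
        change ‖(∫ s in (1 : ℝ)..2, (w (s + h * a N) - w s))
              - (h * a N) • (g (update t N 2) - g (update t N 1))‖ ≤ _
        rw [h4]
        refine (norm_add_le _ _).trans ((add_le_add h1 h3).trans (le_of_eq ?_))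
        rw [abs_mul]
        linear_combination (2 * |a N| * K) * sq_abs h
      · have := (integrable_of_continuous_of_bounded (μ := uniformCube.prod uniformOneTwo)
          (hcd.comp (continuous_update_prod N)) (fun t => hM2 _ _)).integral_prod_left
        simpa only [uniformOneTwo, comp_def,
          intervalIntegral.integral_of_le (one_le_two : (1 : ℝ) ≤ 2)] using this
      · exact (integrable_of_continuous_of_bounded hcu fun t => hM2 _ _).smul (h * a N)
    have hsplit : ∫ t, (g (shiftInit a h (N + 1) t) - g t) ∂uniformCube
        = (∫ t, (g (shiftInit a h (N + 1) t) - g (shiftInit a h N t)) ∂uniformCube)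
          + ∫ t, (g (shiftInit a h N t) - g t) ∂uniformCube := by
      rw [← integral_add]
      · simp
      · exact integrable_of_continuous_of_bounded ((hg.comp hc').sub (hg.comp hc)) fun t => hM2 _ _
      · exact integrable_of_continuous_of_bounded ((hg.comp hc).sub hg) fun t => hM2 _ _
    rw [hsplit, Finset.sum_range_succ, smul_add, smul_smul, add_comm (h • _), add_sub_add_comm]
    refine (norm_add_le _ _).trans ?_
    linarith [hC h]

lemma norm_sum_meanIncrement_le [CompleteSpace Z] {g : (ℕ → ℝ) → Z} {L : ℕ → ℝ} {M : ℝ}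
    (hg : Continuous g) (hM : ∀ t, ‖g t‖ ≤ M)
    (hL : ∀ t n s s', ‖g (update t n s) - g (update t n s')‖ ≤ L n * |s - s'|)
    (a : ℕ → ℝ) (N : ℕ) {R : ℝ}
    (hR : ∀ᶠ h in 𝓝[>] (0 : ℝ), ∀ t : ℕ → ℝ, (∀ n, t n ∈ Icc (1 : ℝ) 2) →
      ‖g (shiftInit a h N t) - g t‖ ≤ h * R) :
    ‖∑ n ∈ Finset.range N, a n • meanIncrement g n‖ ≤ R := by
  obtain ⟨C, hC⟩ := exists_norm_integral_shiftInit_sub_le hg hM hL a N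
  set S := ∑ n ∈ Finset.range N, a n • meanIncrement g n
  have hev : ∀ᶠ h in 𝓝[>] (0 : ℝ), ‖S‖ ≤ R + C * h := by
    filter_upwards [hR, self_mem_nhdsWithin] with h hh (hpos : 0 < h)
    have h1 : ‖∫ t, (g (shiftInit a h N t) - g t) ∂uniformCube‖ ≤ h * R := by
      refine (norm_integral_le_of_norm_le_const (C := h * R) ?_).trans (by simp)
      exact ae_uniformCube_mem_Icc.mono fun t ht => hh t ht
    have h2 : ‖h • S‖ ≤ h * R + C * h ^ 2 := by
      have := norm_sub_norm_le (h • S) (∫ t, (g (shiftInit a h N t) - g t) ∂uniformCube)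
      rw [norm_sub_rev] at this
      linarith [hC h]
    rw [norm_smul, Real.norm_of_nonneg hpos.le] at h2
    refine le_of_mul_le_mul_left ?_ hpos
    linarith
  have hlim : Tendsto (fun h : ℝ => R + C * h) (𝓝[>] 0) (𝓝 R) := by
    have : Continuous fun h : ℝ => R + C * h := by fun_prop
    simpa using (this.tendsto 0).mono_left nhdsWithin_le_nhds
  exact ge_of_tendsto hlim hev

end Cube

section Embedding

variable {X : Type*} [NormedAddCommGroup X] [NormedSpace ℝ X]

lemma Convex.sum_smul_mem_of_zero_mem {F : Set X} (hF : Convex ℝ F) (h0 : (0 : X) ∈ F) {d : ℕ → X}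
    (hd : ∀ n, d n ∈ F) {w : ℕ → ℝ} (hw : ∀ n, 0 ≤ w n) {s : Finset ℕ}
    (hs : ∑ n ∈ s, w n ≤ 1) : ∑ n ∈ s, w n • d n ∈ F := by
  rcases (Finset.sum_nonneg fun n _ => hw n : 0 ≤ ∑ n ∈ s, w n).eq_or_lt' with h | h
  · rw [Finset.sum_eq_zero_iff_of_nonneg fun n _ => hw n] at h
    rwa [Finset.sum_eq_zero fun n hn => by rw [h n hn, zero_smul]]
  · have h1 := hF.smul_mem_of_zero_mem h0 (hF.centerMass_mem (fun n _ => hw n) h fun n _ => hd n)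
      ⟨h.le, hs⟩
    rwa [Finset.centerMass, smul_inv_smul₀ h.ne'] at h1

lemma exists_seq_tsum_smul_mem [CompleteSpace X] [TopologicalSpace.SeparableSpace X] {F : Set X}
    (hFclosed : IsClosed F) (hFconv : Convex ℝ F) (h0F : (0 : X) ∈ F)
    (hspan : (Submodule.span ℝ F).topologicalClosure = ⊤) :
    ∃ e : ℕ → X, Summable (fun n => ‖e n‖) ∧
      (∀ s : ℕ → ℝ, (∀ n, s n ∈ Icc (0 : ℝ) 3) → ∑' n, s n • e n ∈ F) ∧
      (Submodule.span ℝ (range e)).topologicalClosure = ⊤ := by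
  have : Nonempty F := ⟨⟨0, h0F⟩⟩
  have : SecondCountableTopology X := UniformSpace.secondCountable_of_separable X
  set d : ℕ → X := fun n => TopologicalSpace.denseSeq F n with hd
  have hdF : ∀ n, d n ∈ F := fun n => (TopologicalSpace.denseSeq F n).2
  set r : ℕ → ℝ := fun n => (1 / 2) ^ (n + 1) / (3 * (1 + ‖d n‖)) with hr
  have hrpos : ∀ n, 0 < r n := fun n => by positivity
  have hgeo : HasSum (fun n : ℕ => (1 / 2 : ℝ) ^ (n + 1)) 1 := by
    simpa [pow_succ] using hasSum_geometric_two.mul_right (1 / 2 : ℝ)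
  have hr3 : ∀ n, 3 * r n ≤ (1 / 2) ^ (n + 1) := fun n => by
    have h1 : 3 * r n = (1 / 2) ^ (n + 1) / (1 + ‖d n‖) := by
      simp only [hr]; field_simp
    rw [h1]
    exact div_le_self (by positivity) (by linarith [norm_nonneg (d n)])
  have hsum : Summable fun n => ‖r n • d n‖ := by
    refine Summable.of_nonneg_of_le (fun n => norm_nonneg _) (fun n => ?_) hgeo.summable
    rw [norm_smul, Real.norm_of_nonneg (hrpos n).le]
    simp only [hr]
    rw [div_mul_eq_mul_div, div_le_iff₀ (by positivity)]
    exact mul_le_mul_of_nonneg_left (by linarith [norm_nonneg (d n)]) (by positivity)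
  refine ⟨fun n => r n • d n, hsum, fun s hs => ?_, ?_⟩
  · have hs' : Summable fun n => s n • r n • d n := by
      refine Summable.of_norm_bounded (hsum.mul_left 3) fun n => ?_
      rw [norm_smul, Real.norm_of_nonneg (hs n).1]
      exact mul_le_mul_of_nonneg_right (hs n).2 (norm_nonneg _)
    refine hFclosed.mem_of_tendsto hs'.hasSum (Eventually.of_forall fun A => ?_)
    simp only [smul_smul]
    refine hFconv.sum_smul_mem_of_zero_mem h0F hdF
      (fun n => mul_nonneg (hs n).1 (hrpos n).le) ?_
    refine (Finset.sum_le_sum fun n _ => ?_).trans (sum_le_hasSum A (fun n _ => by positivity) hgeo)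
    exact (mul_le_mul_of_nonneg_right (hs n).2 (hrpos n).le).trans (hr3 n)
  · rw [eq_top_iff, ← hspan]
    refine Submodule.topologicalClosure_minimal _ (Submodule.span_le.2 fun x hx => ?_)
      (Submodule.isClosed_topologicalClosure _)
    have hmem : ∀ n, d n ∈ Submodule.span ℝ (range fun n => r n • d n) := fun n => by
      have := Submodule.smul_mem _ (r n)⁻¹
        (Submodule.subset_span (R := ℝ) (mem_range_self (f := fun n => r n • d n) n))
      rwa [inv_smul_smul₀ (hrpos n).ne'] at this
    have hcl : (⟨x, hx⟩ : F) ∈ closure (range (TopologicalSpace.denseSeq F)) :=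
      TopologicalSpace.denseRange_denseSeq F _
    refine map_mem_closure continuous_subtype_val hcl ?_
    rintro _ ⟨n, rfl⟩
    exact hmem n

variable {Z : Type*} [NormedAddCommGroup Z] [NormedSpace ℝ Z]

lemma nonempty_linearIsometry_of_dense_section [CompleteSpace Z] {Q : Z →L[ℝ] X} (W : Submodule ℝ Z)
    (hW : ∀ z ∈ W, ‖Q z‖ = ‖z‖)
    (hdense : (W.map (Q : Z →ₗ[ℝ] X)).topologicalClosure = ⊤) : Nonempty (X →ₗᵢ[ℝ] Z) := by
  have hW' : ∀ z ∈ W.topologicalClosure, ‖Q z‖ = ‖z‖ := fun z hz =>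
    closure_minimal (t := {z | ‖Q z‖ = ‖z‖}) hW
      (isClosed_eq Q.continuous.norm continuous_norm) hz
  let f : W.topologicalClosure →ₗᵢ[ℝ] X :=
    ⟨(Q : Z →ₗ[ℝ] X).comp W.topologicalClosure.subtype, fun z => hW' z z.2⟩
  have hclosed : IsClosed (range f) := f.isometry.isClosedEmbedding.isClosed_range
  have hsurj : Surjective f := by
    rw [← range_eq_univ, eq_univ_iff_forall]
    intro x
    have hx : x ∈ (W.map (Q : Z →ₗ[ℝ] X)).topologicalClosure := hdense ▸ Submodule.mem_top
    refine closure_minimal ?_ hclosed hx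
    rintro _ ⟨z, hz, rfl⟩
    exact ⟨⟨z, W.le_topologicalClosure hz⟩, rfl⟩
  exact ⟨W.topologicalClosure.subtypeₗᵢ.comp
    (LinearIsometryEquiv.ofSurjective f hsurj).symm.toLinearIsometry⟩

lemma nonempty_linearIsometry_of_norm_sum_le [CompleteSpace Z] {Q : Z →L[ℝ] X} (hQ : ‖Q‖ ≤ 1)
    {e : ℕ → X} {u : ℕ → Z} (hu : ∀ n, Q (u n) = e n)
    (hle : ∀ (a : ℕ → ℝ) (N : ℕ),
      ‖∑ n ∈ Finset.range N, a n • u n‖ ≤ ‖∑ n ∈ Finset.range N, a n • e n‖)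
    (hspan : (Submodule.span ℝ (range e)).topologicalClosure = ⊤) : Nonempty (X →ₗᵢ[ℝ] Z) := by
  refine nonempty_linearIsometry_of_dense_section (Q := Q) (Submodule.span ℝ (range u)) ?_ ?_
  · intro z hz
    refine le_antisymm (by simpa using Q.le_of_opNorm_le hQ z) ?_
    rw [← Finsupp.range_linearCombination] at hz
    obtain ⟨a, rfl⟩ := hz
    obtain ⟨N, hN⟩ := Finset.exists_nat_subset_range a.support
    rw [Finsupp.linearCombination_apply, Finsupp.sum_of_support_subset a hN _ (by simp)]
    simpa [hu] using hle a N
  · rw [Submodule.map_span, ← range_comp]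
    have : ((Q : Z →ₗ[ℝ] X) ∘ u) = e := funext hu
    rwa [this]

end Embedding


/-- Let `X` and `Z` be real Banach spaces with `X` separable. Let `F` be a
closed convex subset of `X` containing `0` whose closed linear span is all of `X`. Let
`j : F → Z` be a distance-preserving map with `j 0 = 0`, and suppose there is a bounded linear
operator `Q : Z → X` with `‖Q‖ ≤ 1` such that `Q (j x) = x` for every `x ∈ F`. Then `X` embeds
linearly isometrically into `Z`. -/
theorem stmt0 (X Z : Type*)
    [NormedAddCommGroup X] [NormedSpace ℝ X] [CompleteSpace X]
    [TopologicalSpace.SeparableSpace X]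
    [NormedAddCommGroup Z] [NormedSpace ℝ Z] [CompleteSpace Z]
    (F : Set X) (hFclosed : IsClosed F) (hFconv : Convex ℝ F) (h0F : (0 : X) ∈ F)
    (hspan : (Submodule.span ℝ F).topologicalClosure = ⊤)
    (j : F → Z) (hj : Isometry j) (hj0 : j ⟨0, h0F⟩ = 0)
    (Q : Z →L[ℝ] X) (hQ : ‖Q‖ ≤ 1) (hQj : ∀ x : F, Q (j x) = (x : X)) :
    Nonempty (X →ₗᵢ[ℝ] Z) := by
  obtain ⟨e, he, heF, hespan⟩ := exists_seq_tsum_smul_mem hFclosed hFconv h0F hspan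
  set c : ℝ → ℝ := fun s => max 0 (min 3 s) with hc
  have hcc : Continuous c := by fun_prop
  have hc3 : ∀ s, c s ∈ Icc (0 : ℝ) 3 := fun s =>
    ⟨le_max_left _ _, max_le (by norm_num) (min_le_left _ _)⟩
  have hcid : ∀ s ∈ Icc (0 : ℝ) 3, c s = s := fun s hs => by
    simp only [hc, min_eq_right hs.2, max_eq_right hs.1]
  have hclip : ∀ s s', |c s - c s'| ≤ |s - s'| := fun s s' => by
    refine (abs_max_sub_max_le_max 0 (min 3 s) 0 (min 3 s')).trans (max_le (by simp) ?_)
    exact (abs_min_sub_min_le_max 3 s 3 s').trans (max_le (by simp) le_rfl)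
  set φ : (ℕ → ℝ) → X := fun t => ∑' n, c (t n) • e n with hφ
  have hterm : ∀ (t : ℕ → ℝ) n, ‖c (t n) • e n‖ ≤ 3 * ‖e n‖ := fun t n => by
    rw [norm_smul, Real.norm_of_nonneg (hc3 _).1]
    exact mul_le_mul_of_nonneg_right (hc3 _).2 (norm_nonneg _)
  have hsummable : ∀ t : ℕ → ℝ, Summable fun n => c (t n) • e n := fun t =>
    Summable.of_norm_bounded (he.mul_left 3) (hterm t)
  have hφF : ∀ t, φ t ∈ F := fun t => heF (fun n => c (t n)) fun n => hc3 _
  have hφc : Continuous φ :=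
    continuous_tsum (fun n => (hcc.comp (continuous_apply n)).smul continuous_const)
      (he.mul_left 3) fun n t => hterm t n
  have hφsub : ∀ (t t' : ℕ → ℝ) (A : Finset ℕ), (∀ n ∉ A, t n = t' n) →
      φ t - φ t' = ∑ n ∈ A, (c (t n) - c (t' n)) • e n := fun t t' A h => by
    rw [hφ, ← (hsummable t).tsum_sub (hsummable t')]
    simp only [← sub_smul]
    exact tsum_eq_sum fun n hn => by rw [h n hn, sub_self, zero_smul]
  have hφupd : ∀ t n s s', φ (update t n s) - φ (update t n s') = (c s - c s') • e n :=
    fun t n s s' => by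
      rw [hφsub _ _ {n} fun m hm => by
        rw [update_of_ne (by simpa using hm), update_of_ne (by simpa using hm)]]
      simp
  set g : (ℕ → ℝ) → Z := fun t => j ⟨φ t, hφF t⟩ with hg
  have hgsub : ∀ t t', ‖g t - g t'‖ = ‖φ t - φ t'‖ := fun t t' => by
    rw [← dist_eq_norm, ← dist_eq_norm, hj.dist_eq, Subtype.dist_eq]
  have hgnorm : ∀ t, ‖g t‖ ≤ ∑' n, 3 * ‖e n‖ := fun t => by
    have h1 : ‖g t‖ = ‖φ t‖ := by
      rw [← sub_zero (g t), ← hj0, ← dist_eq_norm, hj.dist_eq, Subtype.dist_eq, dist_zero_right]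
    rw [h1]
    exact tsum_of_norm_bounded (he.mul_left 3).hasSum (hterm t)
  have hgc : Continuous g := hj.continuous.comp (hφc.subtype_mk hφF)
  have hgL : ∀ t n s s', ‖g (update t n s) - g (update t n s')‖ ≤ ‖e n‖ * |s - s'| :=
    fun t n s s' => by
      rw [hgsub, hφupd, norm_smul, mul_comm, Real.norm_eq_abs]
      exact mul_le_mul_of_nonneg_left (hclip s s') (norm_nonneg _)
  refine nonempty_linearIsometry_of_norm_sum_le hQ (e := e) (u := meanIncrement g)
    (fun n => ?_) (fun a N => ?_) hespan
  · have hint : Integrable (fun t => g (update t n 2) - g (update t n 1)) uniformCube :=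
      integrable_of_continuous_of_bounded ((hgc.comp (continuous_update_const n 2)).sub
        (hgc.comp (continuous_update_const n 1))) fun t => hgL t n 2 1
    have hQg : ∀ t, Q (g (update t n 2) - g (update t n 1)) = e n := fun t => by
      rw [map_sub, hQj, hQj, hφupd, hcid 2 (by norm_num), hcid 1 (by norm_num)]
      norm_num
    rw [meanIncrement, ← Q.integral_comp_comm hint]
    simp [hQg]
  · refine norm_sum_meanIncrement_le hgc hgnorm hgL a N ?_
    have hsmall : ∀ᶠ h in 𝓝[>] (0 : ℝ), ∀ n ∈ Finset.range N, |h * a n| < 1 := by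
      rw [Filter.eventually_all_finset]
      intro n _
      have hcont : Continuous fun h : ℝ => |h * a n| := by fun_prop
      exact nhdsWithin_le_nhds (hcont.tendsto 0 |>.eventually_lt_const (by simp))
    filter_upwards [hsmall, self_mem_nhdsWithin] with h hh (hpos : 0 < h) t ht
    rw [hgsub, hφsub _ _ (Finset.range N) fun n hn => by
      simp only [shiftInit, if_neg (mt Finset.mem_range.2 hn), add_zero]]
    have hterms : ∀ n ∈ Finset.range N,
        (c (shiftInit a h N t n) - c (t n)) • e n = h • a n • e n := fun n hn => by
      have h1 := abs_lt.1 (hh n hn)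
      have h2 := ht n
      simp only [shiftInit, if_pos (Finset.mem_range.1 hn)]
      rw [hcid _ ⟨by linarith [h2.1], by linarith [h2.2]⟩,
        hcid _ ⟨by linarith [h2.1], by linarith [h2.2]⟩, add_sub_cancel_left, mul_smul]
    rw [Finset.sum_congr rfl hterms, ← Finset.smul_sum, norm_smul, Real.norm_of_nonneg hpos.le]
end

section
/- Let (R, d) be a compact metric space of diameter at most 1, and let K = {f ∈ C(R) : ‖f‖∞ ≤ 1 and f is 1-Lipschitz}. For every real Banach space Y, if there exists a distance-preserving map from K (with the supremum-norm metric) into Y, then there exists a linear isometric embedding of C(R) into Y. -/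
namespace IsometricLinearization

open Filter Topology

section Averaging

variable {X Y : Type*} [NormedAddCommGroup X] [NormedSpace ℝ X] [NormedAddCommGroup Y]

/-- The mixed second differences of `G` in the direction `g` are bounded by `C`. -/
def HasSecondDiffBound (G : X → Y) (g : X) (C : ℝ) : Prop :=
  ∀ (u v : X) (h : ℝ), ‖G (u + h • g + v) - G (u + h • g) - G (u + v) + G u‖ ≤ C * |h| * ‖v‖

theorem HasSecondDiffBound.add {G : X → Y} {g₁ g₂ : X} {C₁ C₂ : ℝ}
    (h₁ : HasSecondDiffBound G g₁ C₁) (h₂ : HasSecondDiffBound G g₂ C₂) :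
    HasSecondDiffBound G (g₁ + g₂) (C₁ + C₂) := by
  intro u v h
  have e₁ := h₁ (u + h • g₂) v h
  have e₂ := h₂ u v h
  have key : G (u + h • (g₁ + g₂) + v) - G (u + h • (g₁ + g₂)) - G (u + v) + G u
      = (G (u + h • g₂ + h • g₁ + v) - G (u + h • g₂ + h • g₁) - G (u + h • g₂ + v)
          + G (u + h • g₂))
        + (G (u + h • g₂ + v) - G (u + h • g₂) - G (u + v) + G u) := by
    have : u + h • (g₁ + g₂) = u + h • g₂ + h • g₁ := by module
    rw [this]
    abel
  rw [key]
  refine (norm_add_le _ _).trans ?_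
  linarith

theorem HasSecondDiffBound.smul {G : X → Y} {g : X} {C : ℝ} (hg : HasSecondDiffBound G g C)
    (c : ℝ) : HasSecondDiffBound G (c • g) (C * |c|) := by
  intro u v h
  have := hg u v (h * c)
  rw [abs_mul, mul_smul] at this
  linarith

theorem hasSecondDiffBound_zero (G : X → Y) : HasSecondDiffBound G 0 0 := by
  intro u v h
  simp

theorem intervalIntegrable_segment {G : X → Y} (hG : LipschitzWith 1 G) (u x : X)
    (a b : ℝ) : IntervalIntegrable (fun t : ℝ => G (u + t • x)) MeasureTheory.volume a b := by
  apply Continuous.intervalIntegrable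
  have := hG.continuous
  fun_prop

variable [NormedSpace ℝ Y]

/-- The average of `G` over the segment from `u` to `u + x`. -/
noncomputable def segAvg (x : X) (G : X → Y) (u : X) : Y := ∫ t in (0 : ℝ)..1, G (u + t • x)

theorem norm_integral_unit_le {f : ℝ → Y} {C : ℝ} (hf : ∀ t ∈ Set.Icc (0 : ℝ) 1, ‖f t‖ ≤ C) :
    ‖∫ t in (0 : ℝ)..1, f t‖ ≤ C := by
  have := intervalIntegral.norm_integral_le_of_norm_le_const (a := 0) (b := 1) (f := f) (C := C)
    (fun t ht => by
      rw [Set.uIoc_of_le zero_le_one] at ht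
      exact hf t ⟨ht.1.le, ht.2⟩)
  simpa using this

theorem norm_segAvg_sub_le {G G' : X → Y} (hG : LipschitzWith 1 G) (hG' : LipschitzWith 1 G')
    (x u u' : X) {ε : ℝ}
    (h : ∀ t ∈ Set.Icc (0 : ℝ) 1, ‖G (u + t • x) - G' (u' + t • x)‖ ≤ ε) :
    ‖segAvg x G u - segAvg x G' u'‖ ≤ ε := by
  rw [segAvg, segAvg, ← intervalIntegral.integral_sub
    (intervalIntegrable_segment hG _ _ _ _)
    (intervalIntegrable_segment hG' _ _ _ _)]
  exact norm_integral_unit_le h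

theorem lipschitzWith_segAvg {G : X → Y} (hG : LipschitzWith 1 G) (x : X) :
    LipschitzWith 1 (segAvg x G) := by
  refine LipschitzWith.of_dist_le_mul fun u u' => ?_
  rw [dist_eq_norm]
  refine norm_segAvg_sub_le hG hG x u u' fun t _ => ?_
  rw [← dist_eq_norm]
  simpa using hG.dist_le_mul (u + t • x) (u' + t • x)

theorem norm_segAvg_sub_self_le [CompleteSpace Y] {G : X → Y} (hG : LipschitzWith 1 G) (x u : X) :
    ‖segAvg x G u - G u‖ ≤ ‖x‖ := by
  have : G u = ∫ _ in (0 : ℝ)..1, G u := by simp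
  rw [this, segAvg, ← intervalIntegral.integral_sub
    (intervalIntegrable_segment hG _ _ _ _) (by simp)]
  refine norm_integral_unit_le fun t ht => ?_
  rw [← dist_eq_norm]
  refine (hG.dist_le_mul _ _).trans ?_
  simp only [NNReal.coe_one, one_mul, dist_self_add_left, norm_smul, Real.norm_eq_abs,
    abs_of_nonneg ht.1]
  exact mul_le_of_le_one_left (norm_nonneg _) ht.2

theorem segAvg_secondDiff {G : X → Y} (hG : LipschitzWith 1 G) (x u v w : X) :
    segAvg x G (u + w + v) - segAvg x G (u + w) - segAvg x G (u + v) + segAvg x G u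
      = ∫ t in (0 : ℝ)..1, (G (u + t • x + w + v) - G (u + t • x + w) - G (u + t • x + v)
          + G (u + t • x)) := by
  have hi := fun z => intervalIntegrable_segment hG z x 0 1
  have hc : ∀ t : ℝ, G (u + t • x + w + v) - G (u + t • x + w) - G (u + t • x + v)
      + G (u + t • x) = G (u + w + v + t • x) - G (u + w + t • x) - G (u + v + t • x)
      + G (u + t • x) := fun t => by
    rw [show u + t • x + w + v = u + w + v + t • x by abel,
      show u + t • x + w = u + w + t • x by abel, show u + t • x + v = u + v + t • x by abel]
  simp only [hc, segAvg]
  rw [intervalIntegral.integral_add (((hi _).sub (hi _)).sub (hi _)) (hi _),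
    intervalIntegral.integral_sub ((hi _).sub (hi _)) (hi _),
    intervalIntegral.integral_sub (hi _) (hi _)]

theorem HasSecondDiffBound.segAvg {G : X → Y} (hG : LipschitzWith 1 G) {g : X} {C : ℝ}
    (hg : HasSecondDiffBound G g C) (x : X) : HasSecondDiffBound (segAvg x G) g C := by
  intro u v h
  rw [segAvg_secondDiff hG]
  exact norm_integral_unit_le fun t _ => hg _ _ _

/-- Averaging along `x` makes second differences in the direction `x` bounded. -/
theorem hasSecondDiffBound_segAvg_self {G : X → Y} (hG : LipschitzWith 1 G) (x : X) :
    HasSecondDiffBound (segAvg x G) x 2 := by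
  intro u v h
  set K : ℝ → Y := fun t => G (u + t • x + v) - G (u + t • x) with hK
  have hKc : Continuous K := by
    have := hG.continuous
    fun_prop
  have hKi : ∀ a b : ℝ, IntervalIntegrable K MeasureTheory.volume a b :=
    fun a b => hKc.intervalIntegrable a b
  have hKb : ∀ t, ‖K t‖ ≤ ‖v‖ := fun t => by
    rw [hK, ← dist_eq_norm]
    simpa using hG.dist_le_mul (u + t • x + v) (u + t • x)
  have hbound : ∀ a b : ℝ, ‖∫ t in a..b, K t‖ ≤ ‖v‖ * |b - a| := fun a b =>
    intervalIntegral.norm_integral_le_of_norm_le_const fun t _ => hKb t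
  have key : IsometricLinearization.segAvg x G (u + h • x + v)
      - IsometricLinearization.segAvg x G (u + h • x)
      - IsometricLinearization.segAvg x G (u + v) + IsometricLinearization.segAvg x G u
      = (∫ t in (1 : ℝ)..(1 + h), K t) - ∫ t in (0 : ℝ)..h, K t := by
    rw [segAvg_secondDiff hG]
    have e : ∀ t : ℝ, G (u + t • x + h • x + v) - G (u + t • x + h • x) - G (u + t • x + v)
        + G (u + t • x) = K (t + h) - K t := fun t => by
      simp only [hK, add_smul, ← add_assoc]
      abel
    simp only [e]
    have hsh : Continuous fun t => K (t + h) := by fun_prop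
    rw [intervalIntegral.integral_sub (hsh.intervalIntegrable _ _) (hKi _ _),
      intervalIntegral.integral_comp_add_right, zero_add]
    have a₁ := intervalIntegral.integral_add_adjacent_intervals (hKi 0 h) (hKi h (1 + h))
    have a₂ := intervalIntegral.integral_add_adjacent_intervals (hKi 0 1) (hKi 1 (1 + h))
    rw [sub_eq_sub_iff_add_eq_add, add_comm _ (∫ t in (0 : ℝ)..h, K t), a₁, ← a₂]
    exact add_comm _ _
  rw [key]
  refine (norm_sub_le _ _).trans ?_
  have b₁ := hbound 1 (1 + h)
  have b₂ := hbound 0 h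
  simp only [add_sub_cancel_left, sub_zero] at b₁ b₂
  linarith

/-- Successive averages of `G` along `x (n - 1)`, …, `x 0`. -/
noncomputable def iterAvg (x : ℕ → X) : ℕ → (X → Y) → X → Y
  | 0, G => G
  | n + 1, G => iterAvg x n (segAvg (x n) G)

theorem lipschitzWith_iterAvg (x : ℕ → X) (n : ℕ) {G : X → Y} (hG : LipschitzWith 1 G) :
    LipschitzWith 1 (iterAvg x n G) := by
  induction n generalizing G with
  | zero => exact hG
  | succ n ih => exact ih (lipschitzWith_segAvg hG _)

theorem norm_iterAvg_sub_le (x : ℕ → X) (n : ℕ) {G G' : X → Y} (hG : LipschitzWith 1 G)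
    (hG' : LipschitzWith 1 G') {ε : ℝ} (h : ∀ u, ‖G u - G' u‖ ≤ ε) (u : X) :
    ‖iterAvg x n G u - iterAvg x n G' u‖ ≤ ε := by
  induction n generalizing G G' with
  | zero => exact h u
  | succ n ih =>
    exact ih (lipschitzWith_segAvg hG _) (lipschitzWith_segAvg hG' _)
      fun u => norm_segAvg_sub_le hG hG' _ _ _ fun t _ => h _

theorem HasSecondDiffBound.iterAvg (x : ℕ → X) (n : ℕ) {G : X → Y} (hG : LipschitzWith 1 G)
    {g : X} {C : ℝ} (hg : HasSecondDiffBound G g C) :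
    HasSecondDiffBound (iterAvg x n G) g C := by
  induction n generalizing G with
  | zero => exact hg
  | succ n ih => exact ih (lipschitzWith_segAvg hG _) (hg.segAvg hG _)

theorem hasSecondDiffBound_iterAvg_self (x : ℕ → X) {k n : ℕ} (hk : k < n) {G : X → Y}
    (hG : LipschitzWith 1 G) : HasSecondDiffBound (iterAvg x n G) (x k) 2 := by
  induction n generalizing G with
  | zero => omega
  | succ n ih =>
    rcases Nat.lt_succ_iff_lt_or_eq.1 hk with hk | rfl
    · exact ih hk (lipschitzWith_segAvg hG _)
    · exact (hasSecondDiffBound_segAvg_self hG _).iterAvg x k (lipschitzWith_segAvg hG _)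

/-- If `ℓ ∘ G` agrees, up to a constant, with a linear functional on the sets `S a` for small `a`,
so do the averages of `G`. -/
theorem iterAvg_functional_eq [CompleteSpace Y] (x : ℕ → X) (ε : ℕ → ℝ) (hε : ∀ n, 0 ≤ ε n)
    (S : ℝ → Set X)
    (hS : ∀ (a : ℝ) (n : ℕ) (t : ℝ), t ∈ Set.Icc (0 : ℝ) 1 → ∀ u ∈ S a,
      u + t • x n ∈ S (a + ε n))
    (hS₀ : ∀ a, 0 ≤ a → (0 : X) ∈ S a)
    (ℓ : Y →L[ℝ] ℝ) (e : X →ₗ[ℝ] ℝ) (n : ℕ) {a : ℝ} (ha : 0 ≤ a) {G : X → Y}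
    (hG : LipschitzWith 1 G)
    (h : ∀ u ∈ S (a + ∑ i ∈ Finset.range n, ε i), ℓ (G u) - ℓ (G 0) = e u) (u : X)
    (hu : u ∈ S a) : ℓ (iterAvg x n G u) - ℓ (iterAvg x n G 0) = e u := by
  induction n generalizing G with
  | zero => exact h u (by simpa using hu)
  | succ n ih =>
    refine ih (lipschitzWith_segAvg hG _) fun w hw => ?_
    have hi : ∀ z, IntervalIntegrable (fun t : ℝ => ℓ (G (z + t • x n)))
        MeasureTheory.volume 0 1 := fun z =>
      (by have := hG.continuous; fun_prop :
        Continuous fun t : ℝ => ℓ (G (z + t • x n))).intervalIntegrable _ _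
    have hmem : ∀ z ∈ S (a + ∑ i ∈ Finset.range n, ε i), ∀ t ∈ Set.Icc (0 : ℝ) 1,
        ℓ (G (z + t • x n)) - ℓ (G 0) = e z + t * e (x n) := fun z hz t ht => by
      have := h (z + t • x n) (by
        rw [Finset.sum_range_succ, ← add_assoc]
        exact hS _ n t ht z hz)
      simpa using this
    have h0 := hS₀ (a + ∑ i ∈ Finset.range n, ε i)
      (add_nonneg ha (Finset.sum_nonneg fun i _ => hε i))
    rw [segAvg, segAvg, ← ℓ.intervalIntegral_comp_comm (intervalIntegrable_segment hG _ _ _ _),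
      ← ℓ.intervalIntegral_comp_comm (intervalIntegrable_segment hG _ _ _ _),
      ← intervalIntegral.integral_sub (hi _) (hi _),
      intervalIntegral.integral_congr (g := fun _ => e w)]
    · simp
    · intro t ht
      rw [Set.uIcc_of_le zero_le_one] at ht
      have h₁ := hmem w hw t ht
      have h₂ := hmem 0 h0 t ht
      simp only [map_zero] at h₂
      simp only
      linarith

end Averaging

section Linearization

variable {X Y : Type*} [NormedAddCommGroup X] [NormedSpace ℝ X]
  [NormedAddCommGroup Y] [NormedSpace ℝ Y]

/-- The dyadic difference quotients of `ψ` at `0` in the direction `g`. -/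
noncomputable def dyadicQuotient (ψ : X → Y) (g : X) (m : ℕ) : Y :=
  (2 : ℝ) ^ m • (ψ ((2⁻¹ : ℝ) ^ m • g) - ψ 0)

theorem norm_dyadicQuotient_le {ψ : X → Y} (hψ : LipschitzWith 1 ψ) (g : X) (m : ℕ) :
    ‖dyadicQuotient ψ g m‖ ≤ ‖g‖ := by
  have h := hψ.dist_le_mul ((2⁻¹ : ℝ) ^ m • g) 0
  rw [dist_eq_norm, dist_zero_right, norm_smul] at h
  rw [dyadicQuotient, norm_smul]
  calc ‖(2 : ℝ) ^ m‖ * ‖ψ ((2⁻¹ : ℝ) ^ m • g) - ψ 0‖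
      ≤ ‖(2 : ℝ) ^ m‖ * ((1 : NNReal) * (‖(2⁻¹ : ℝ) ^ m‖ * ‖g‖)) := by gcongr
    _ = ‖g‖ := by
      rw [NNReal.coe_one, one_mul, ← mul_assoc, ← norm_mul, ← mul_pow]
      norm_num

theorem HasSecondDiffBound.norm_dyadicQuotient_add_le {ψ : X → Y} {g : X} {C : ℝ}
    (hg : HasSecondDiffBound ψ g C) (g' : X) (m : ℕ) :
    ‖dyadicQuotient ψ (g + g') m - dyadicQuotient ψ g m - dyadicQuotient ψ g' m‖
      ≤ C * ‖g'‖ * 2⁻¹ ^ m := by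
  have h := hg 0 ((2⁻¹ : ℝ) ^ m • g') ((2⁻¹ : ℝ) ^ m)
  rw [zero_add, zero_add, ← smul_add, norm_smul] at h
  have e : dyadicQuotient ψ (g + g') m - dyadicQuotient ψ g m - dyadicQuotient ψ g' m
      = (2 : ℝ) ^ m • (ψ ((2⁻¹ : ℝ) ^ m • (g + g')) - ψ ((2⁻¹ : ℝ) ^ m • g)
        - ψ ((2⁻¹ : ℝ) ^ m • g') + ψ 0) := by
    simp only [dyadicQuotient]
    module
  rw [e, norm_smul]
  have hp : (0 : ℝ) < 2⁻¹ ^ m := by positivity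
  have h2 : (2 : ℝ) ^ m * 2⁻¹ ^ m = 1 := by rw [← mul_pow]; norm_num
  rw [Real.norm_of_nonneg (by positivity : (0 : ℝ) ≤ 2 ^ m)]
  rw [Real.norm_of_nonneg hp.le, abs_of_pos hp] at h
  calc _ ≤ (2 : ℝ) ^ m * (C * 2⁻¹ ^ m * (2⁻¹ ^ m * ‖g'‖)) := by gcongr
    _ = (2 ^ m * 2⁻¹ ^ m) * (C * ‖g'‖ * 2⁻¹ ^ m) := by ring
    _ = _ := by rw [h2, one_mul]

theorem HasSecondDiffBound.cauchySeq_dyadicQuotient {ψ : X → Y} {g : X} {C : ℝ}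
    (hg : HasSecondDiffBound ψ g C) : CauchySeq (dyadicQuotient ψ g) := by
  refine cauchySeq_of_le_geometric 2⁻¹ (C * |2⁻¹| * ‖(2⁻¹ : ℝ) • g‖)
    (by norm_num) fun m => ?_
  have h := (hg.smul (2⁻¹ : ℝ)).norm_dyadicQuotient_add_le ((2⁻¹ : ℝ) • g) m
  have e₁ : (2⁻¹ : ℝ) • g + (2⁻¹ : ℝ) • g = g := by module
  have e₂ : (2 : ℝ) • dyadicQuotient ψ ((2⁻¹ : ℝ) • g) m = dyadicQuotient ψ g (m + 1) := by
    simp only [dyadicQuotient, smul_smul, pow_succ]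
    rw [mul_comm (2 : ℝ)]
  rw [e₁, sub_sub, ← two_smul ℝ, e₂, ← dist_eq_norm] at h
  exact h

variable [CompleteSpace Y]

/-- A `1`-Lipschitz map whose second differences are bounded in a dense set of directions, and which
does not contract small vectors in these directions, yields a linear isometric embedding. -/
theorem nonempty_linearIsometry_of_secondDiffBound {ψ : X → Y} (hψ : LipschitzWith 1 ψ)
    (D : Submodule ℝ X) (hD : Dense (D : Set X))
    (hbound : ∀ g ∈ D, ∃ C, HasSecondDiffBound ψ g C)
    (hlow : ∀ g ∈ D, ∀ᶠ h : ℝ in 𝓝 0, |h| * ‖g‖ ≤ ‖ψ (h • g) - ψ 0‖) :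
    Nonempty (X →ₗᵢ[ℝ] Y) := by
  have hlim : ∀ g : D, ∃ y, Tendsto (dyadicQuotient ψ (g : X)) atTop (𝓝 y) := fun g => by
    obtain ⟨C, hC⟩ := hbound g g.2
    exact cauchySeq_tendsto_of_complete hC.cauchySeq_dyadicQuotient
  choose T hT using hlim
  have hpow : Tendsto (fun m : ℕ => (2⁻¹ : ℝ) ^ m) atTop (𝓝 0) :=
    tendsto_pow_atTop_nhds_zero_of_lt_one (by norm_num) (by norm_num)
  have hnorm : ∀ g : D, ‖T g‖ = ‖(g : X)‖ := fun g => by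
    refine le_antisymm (le_of_tendsto' (hT g).norm fun m => norm_dyadicQuotient_le hψ _ _)
      (ge_of_tendsto (hT g).norm ?_)
    filter_upwards [hpow.eventually (hlow g g.2)] with m hm
    have hp : (0 : ℝ) < 2⁻¹ ^ m := by positivity
    have h2 : (2 : ℝ) ^ m * 2⁻¹ ^ m = 1 := by rw [← mul_pow]; norm_num
    rw [abs_of_pos hp] at hm
    rw [dyadicQuotient, norm_smul, Real.norm_of_nonneg (by positivity : (0 : ℝ) ≤ 2 ^ m)]
    calc ‖(g : X)‖ = 2 ^ m * (2⁻¹ ^ m * ‖(g : X)‖) := by rw [← mul_assoc, h2, one_mul]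
      _ ≤ _ := by gcongr
  have hadd : ∀ g g' : D, T (g + g') = T g + T g' := fun g g' => by
    obtain ⟨C, hC⟩ := hbound g g.2
    have h₁ := ((hT (g + g')).sub (hT g)).sub (hT g')
    have h₂ : Tendsto (fun m : ℕ => C * ‖(g' : X)‖ * 2⁻¹ ^ m) atTop (𝓝 0) := by
      simpa using hpow.const_mul (C * ‖(g' : X)‖)
    have h₃ := squeeze_zero_norm (fun m => hC.norm_dyadicQuotient_add_le (g' : X) m) h₂
    have := tendsto_nhds_unique h₁ h₃
    rwa [sub_sub, sub_eq_zero] at this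
  let A : D →+ Y := AddMonoidHom.mk' T hadd
  have hA : Continuous A :=
    AddMonoidHomClass.continuous_of_bound A 1 fun g => by
      rw [one_mul]
      exact (hnorm g).le
  let L : D →ₗ[ℝ] Y := (A.toRealLinearMap hA).toLinearMap
  have hL : ∀ g : D, ‖L g‖ = ‖D.subtype g‖ := hnorm
  have hdense : DenseRange D.subtype := by simpa [DenseRange] using hD
  refine ⟨⟨(L.extendOfNorm D.subtype).toLinearMap, fun x => ?_⟩⟩
  refine hdense.induction_on (p := fun x => ‖L.extendOfNorm D.subtype x‖ = ‖x‖) x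
    (isClosed_eq (by fun_prop) (by fun_prop)) fun g => ?_
  rw [LinearMap.extendOfNorm_eq hdense ⟨1, fun g => by rw [one_mul, hL]⟩, hL]

/-- Infinitely many averages along directions whose norms decay geometrically regularize a
`1`-Lipschitz map in all these directions. -/
theorem exists_tendsto_iterAvg (x : ℕ → X) {c : ℝ} (hx : ∀ n, ‖x n‖ ≤ c * 2⁻¹ ^ n) {φ : X → Y}
    (hφ : LipschitzWith 1 φ) :
    ∃ ψ : X → Y, LipschitzWith 1 ψ ∧ (∀ u, Tendsto (fun n => iterAvg x n φ u) atTop (𝓝 (ψ u))) ∧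
      ∀ k, HasSecondDiffBound ψ (x k) 2 := by
  have hlim : ∀ u, ∃ y, Tendsto (fun n => iterAvg x n φ u) atTop (𝓝 y) := fun u => by
    refine cauchySeq_tendsto_of_complete
      (cauchySeq_of_le_geometric 2⁻¹ c (by norm_num) fun n => ?_)
    rw [dist_comm, dist_eq_norm]
    exact norm_iterAvg_sub_le x n (lipschitzWith_segAvg hφ _) hφ
      (fun u => (norm_segAvg_sub_self_le hφ _ _).trans (hx n)) u
  choose ψ hψ using hlim
  refine ⟨ψ, LipschitzWith.of_dist_le_mul fun u v => ?_, hψ, fun k u v h => ?_⟩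
  · exact le_of_tendsto' ((hψ u).dist (hψ v)) fun n =>
      (lipschitzWith_iterAvg x n hφ).dist_le_mul u v
  · refine le_of_tendsto ((((hψ _).sub (hψ _)).sub (hψ _)).add (hψ _)).norm ?_
    filter_upwards [eventually_gt_atTop k] with n hn
    exact hasSecondDiffBound_iterAvg_self x hn hφ u v h

end Linearization

section ContinuousFunctions

variable {R : Type*} [MetricSpace R]

/-- The functions which are `a`-Lipschitz and bounded by `a`. -/
def lipBall (R : Type*) [MetricSpace R] (a : ℝ) : Set C(R, ℝ) :=
  {f | (∀ s t, |f s - f t| ≤ a * dist s t) ∧ ∀ t, |f t| ≤ a}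

theorem zero_mem_lipBall {a : ℝ} (ha : 0 ≤ a) : (0 : C(R, ℝ)) ∈ lipBall R a :=
  ⟨fun s t => by simpa using mul_nonneg ha dist_nonneg, fun t => by simpa using ha⟩

theorem lipBall_mono {a b : ℝ} (h : a ≤ b) : lipBall R a ⊆ lipBall R b := fun f hf =>
  ⟨fun s t => (hf.1 s t).trans (by gcongr), fun t => (hf.2 t).trans h⟩

theorem add_mem_lipBall {a b : ℝ} {f g : C(R, ℝ)} (hf : f ∈ lipBall R a) (hg : g ∈ lipBall R b) :
    f + g ∈ lipBall R (a + b) := by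
  refine ⟨fun s t => ?_, fun t => (abs_add_le _ _).trans (add_le_add (hf.2 t) (hg.2 t))⟩
  have e : (f + g) s - (f + g) t = (f s - f t) + (g s - g t) := by
    simp only [ContinuousMap.add_apply]
    ring
  rw [e, add_mul]
  exact (abs_add_le _ _).trans (add_le_add (hf.1 s t) (hg.1 s t))

theorem smul_mem_lipBall {a : ℝ} {f : C(R, ℝ)} (hf : f ∈ lipBall R a) (c : ℝ) :
    c • f ∈ lipBall R (|c| * a) := by
  refine ⟨fun s t => ?_, fun t => ?_⟩
  · simp only [ContinuousMap.smul_apply, smul_eq_mul]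
    rw [← mul_sub, abs_mul, mul_assoc]
    exact mul_le_mul_of_nonneg_left (hf.1 s t) (abs_nonneg c)
  · simp only [ContinuousMap.smul_apply, smul_eq_mul]
    rw [abs_mul]
    exact mul_le_mul_of_nonneg_left (hf.2 t) (abs_nonneg c)

theorem nonneg_of_mem_lipBall [Nonempty R] {a : ℝ} {f : C(R, ℝ)} (hf : f ∈ lipBall R a) : 0 ≤ a :=
  (abs_nonneg _).trans (hf.2 (Classical.arbitrary R))

variable [CompactSpace R]

theorem mem_lipBall_iff {a : NNReal} {f : C(R, ℝ)} :
    f ∈ lipBall R a ↔ ‖f‖ ≤ a ∧ LipschitzWith a f := by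
  rw [ContinuousMap.norm_le f a.coe_nonneg, lipschitzWith_iff_dist_le_mul, and_comm]
  rfl

/-- Evaluation at a point is recovered, on small functions, from an isometric copy of the set of
`1`-Lipschitz functions bounded by `1`. -/
theorem exists_functional_eq_eval {Y : Type*} [NormedAddCommGroup Y] [NormedSpace ℝ Y]
    (hdiam : Metric.diam (Set.univ : Set R) ≤ 1)
    {j : {f : C(R, ℝ) | ‖f‖ ≤ 1 ∧ LipschitzWith 1 f} → Y} (hj : Isometry j) (x : R) :
    ∃ ℓ : Y →L[ℝ] ℝ, ‖ℓ‖ ≤ 1 ∧ ∃ c, ∀ f : {f : C(R, ℝ) | ‖f‖ ≤ 1 ∧ LipschitzWith 1 f},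
      (∀ t, |(f : C(R, ℝ)) t| ≤ 1 / 2) →
      ℓ (j f) = (f : C(R, ℝ)) x + c := by
  have hd : ∀ t, dist t x ≤ 1 := fun t =>
    (Metric.dist_le_diam_of_mem isCompact_univ.isBounded (Set.mem_univ _) (Set.mem_univ _)).trans
      hdiam
  let p : C(R, ℝ) := ⟨fun t => 1 - dist t x, by fun_prop⟩
  have hpx : p x = 1 := by simp [p]
  have hp : p ∈ lipBall R (1 : NNReal) := by
    refine ⟨fun s t => ?_, fun t => ?_⟩
    · have e : p s - p t = dist t x - dist s x := by
        simp only [p, ContinuousMap.coe_mk]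
        ring
      rw [e, NNReal.coe_one, one_mul, dist_comm s t]
      exact abs_dist_sub_le _ _ _
    · have h₁ := hd t
      have h₂ : 0 ≤ dist t x := dist_nonneg
      rw [NNReal.coe_one, abs_le]
      simp only [p, ContinuousMap.coe_mk]
      constructor <;> linarith
  have hn : -p ∈ lipBall R (1 : NNReal) := by simpa using smul_mem_lipBall hp (-1)
  let P : {f : C(R, ℝ) | ‖f‖ ≤ 1 ∧ LipschitzWith 1 f} := ⟨p, mem_lipBall_iff.1 hp⟩
  let N : {f : C(R, ℝ) | ‖f‖ ≤ 1 ∧ LipschitzWith 1 f} := ⟨-p, mem_lipBall_iff.1 hn⟩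
  obtain ⟨ℓ, hℓ, hPN⟩ := exists_dual_vector'' ℝ (j P - j N)
  have hnorm : 2 ≤ ‖j P - j N‖ := by
    rw [← dist_eq_norm, hj.dist_eq, Subtype.dist_eq]
    have := ContinuousMap.dist_apply_le_dist (f := p) (g := -p) x
    rw [ContinuousMap.neg_apply, hpx, Real.dist_eq] at this
    norm_num at this
    exact this
  have hle : ∀ f g, ℓ (j f) - ℓ (j g) ≤ dist f g := fun f g => by
    rw [← map_sub, ← hj.dist_eq, dist_eq_norm]
    exact (le_abs_self _).trans (ℓ.le_of_opNorm_le_of_le hℓ le_rfl |>.trans (one_mul _).le)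
  refine ⟨ℓ, hℓ, ℓ (j P) - 1, fun f hf => ?_⟩
  have hfx := abs_le.1 (hf x)
  have hflip : ∀ t, |(f : C(R, ℝ)) t - (f : C(R, ℝ)) x| ≤ dist t x := fun t => by
    simpa [Real.dist_eq] using f.2.2.dist_le_mul t x
  have h₁ : dist P f ≤ 1 - (f : C(R, ℝ)) x := by
    rw [Subtype.dist_eq, ContinuousMap.dist_le (by linarith)]
    intro t
    have := abs_le.1 (hflip t)
    have := abs_le.1 (hf t)
    have := hd t
    rw [Real.dist_eq, abs_le]
    simp only [P, p, ContinuousMap.coe_mk]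
    constructor <;> linarith
  have h₂ : dist f N ≤ 1 + (f : C(R, ℝ)) x := by
    rw [Subtype.dist_eq, ContinuousMap.dist_le (by linarith)]
    intro t
    have := abs_le.1 (hflip t)
    have := abs_le.1 (hf t)
    have := hd t
    rw [Real.dist_eq, abs_le]
    simp only [N, p, ContinuousMap.neg_apply, ContinuousMap.coe_mk]
    constructor <;> linarith
  have h₃ := hle P f
  have h₄ := hle f N
  rw [map_sub] at hPN
  simp only [RCLike.ofReal_real_eq_id, id_eq] at hPN
  linarith

/-- The largest `K`-Lipschitz minorant of `f`. -/
noncomputable def lipMinorant (K : NNReal) (f : C(R, ℝ)) (t : R) : ℝ := ⨅ s, f s + K * dist s t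

theorem lipMinorant_le_add (K : NNReal) (f : C(R, ℝ)) (s t : R) :
    lipMinorant K f t ≤ f s + K * dist s t := by
  refine ciInf_le ⟨-‖f‖, ?_⟩ s
  rintro _ ⟨s, rfl⟩
  have := (abs_le.1 (f.norm_coe_le_norm s)).1
  have : 0 ≤ K * dist s t := by positivity
  simp only
  linarith

theorem lipMinorant_le (K : NNReal) (f : C(R, ℝ)) (t : R) : lipMinorant K f t ≤ f t := by
  simpa using lipMinorant_le_add K f t t

variable [Nonempty R]

theorem lipschitzWith_lipMinorant (K : NNReal) (f : C(R, ℝ)) :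
    LipschitzWith K (lipMinorant K f) := by
  refine LipschitzWith.of_le_add_mul K fun t t' => ?_
  rw [← sub_le_iff_le_add]
  refine le_ciInf fun s => ?_
  have h := lipMinorant_le_add K f s t
  have : K * dist s t ≤ K * (dist s t' + dist t t') := by
    gcongr
    exact dist_triangle_right _ _ _
  linarith

theorem lipMinorant_eq {K : NNReal} {f : C(R, ℝ)} (hf : LipschitzWith K f) (t : R) :
    lipMinorant K f t = f t := by
  refine le_antisymm (lipMinorant_le K f t) (le_ciInf fun s => ?_)
  have := hf.le_add_mul t s
  rwa [dist_comm] at this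

theorem lipMinorant_le_lipMinorant_add (K : NNReal) (f g : C(R, ℝ)) (t : R) :
    lipMinorant K f t ≤ lipMinorant K g t + dist f g := by
  rw [← sub_le_iff_le_add]
  refine le_ciInf fun s => ?_
  have h := lipMinorant_le_add K f s t
  have := (abs_le.1 ((Real.dist_eq _ _).symm.le.trans (f.dist_apply_le_dist (g := g) s))).2
  linarith

theorem abs_lipMinorant_sub_le (K : NNReal) (f g : C(R, ℝ)) (t : R) :
    |lipMinorant K f t - lipMinorant K g t| ≤ dist f g := by
  have h₁ := lipMinorant_le_lipMinorant_add K f g t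
  have h₂ := lipMinorant_le_lipMinorant_add K g f t
  rw [dist_comm] at h₂
  rw [abs_le]
  constructor <;> linarith

/-- Functions that are Lipschitz are dense among continuous functions on a compact metric space. -/
theorem dense_lipschitz : Dense {f : C(R, ℝ) | ∃ a, f ∈ lipBall R a} := by
  rw [Metric.dense_iff]
  intro f r hr
  obtain ⟨δ, hδ, hf⟩ := Metric.uniformContinuous_iff.1
    (CompactSpace.uniformContinuous_of_continuous f.continuous) (r / 2) (by positivity)
  let K : NNReal := ⟨2 * ‖f‖ / δ, by positivity⟩
  let g : C(R, ℝ) := ⟨lipMinorant K f, (lipschitzWith_lipMinorant K f).continuous⟩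
  have hg : ∀ t, |g t - f t| ≤ r / 2 := fun t => by
    have h₁ : g t ≤ f t := lipMinorant_le K f t
    have h₂ : f t - r / 2 ≤ g t := le_ciInf fun s => by
      have hK : 0 ≤ K * dist s t := by positivity
      rcases lt_or_ge (dist s t) δ with h | h
      · have := (abs_lt.1 ((Real.dist_eq _ _).symm.le.trans_lt (hf h))).1
        linarith
      · have : 2 * ‖f‖ ≤ K * dist s t := by
          calc 2 * ‖f‖ = 2 * ‖f‖ / δ * δ := by field_simp
            _ ≤ 2 * ‖f‖ / δ * dist s t := by gcongr
        have h₃ := (abs_le.1 (f.norm_coe_le_norm s)).1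
        have h₄ := (abs_le.1 (f.norm_coe_le_norm t)).2
        linarith
    rw [abs_le]
    constructor <;> linarith
  refine ⟨g, ?_, max K ‖g‖₊, ?_⟩
  · rw [Metric.mem_ball]
    exact ((ContinuousMap.dist_le (by positivity)).2 hg).trans_lt (half_lt_self hr)
  · rw [← NNReal.coe_max]
    refine mem_lipBall_iff.2 ⟨?_, (lipschitzWith_lipMinorant K f).weaken (le_max_left _ _)⟩
    rw [NNReal.coe_max]
    exact le_max_right _ _

/-- The `1`-Lipschitz functions bounded by `1` form a nonexpansive retract. -/
theorem exists_lipschitzWith_retraction :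
    ∃ r : C(R, ℝ) → {f : C(R, ℝ) | ‖f‖ ≤ 1 ∧ LipschitzWith 1 f}, LipschitzWith 1 r ∧
      ∀ f : {f : C(R, ℝ) | ‖f‖ ≤ 1 ∧ LipschitzWith 1 f}, r f = f := by
  have hlip : ∀ f : C(R, ℝ), LipschitzWith 1 fun t => max (min (lipMinorant 1 f t) 1) (-1) :=
    fun f => ((lipschitzWith_lipMinorant 1 f).min_const 1).max_const (-1)
  have hnorm : ∀ f : C(R, ℝ),
      ‖(⟨fun t => max (min (lipMinorant 1 f t) 1) (-1), (hlip f).continuous⟩ : C(R, ℝ))‖ ≤ 1 :=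
    fun f => (ContinuousMap.norm_le _ zero_le_one).2 fun t =>
      abs_le.2 ⟨le_max_right _ _, max_le (min_le_right _ _) (by norm_num)⟩
  refine ⟨fun f => ⟨⟨fun t => max (min (lipMinorant 1 f t) 1) (-1), (hlip f).continuous⟩,
    hnorm f, hlip f⟩, LipschitzWith.of_dist_le_mul fun f g => ?_, fun ⟨f, hf⟩ => ?_⟩
  · rw [NNReal.coe_one, one_mul, Subtype.dist_eq, ContinuousMap.dist_le dist_nonneg]
    intro t
    rw [Real.dist_eq]
    have h₁ := abs_max_sub_max_le_max (min (lipMinorant 1 f t) 1) (-1)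
      (min (lipMinorant 1 g t) 1) (-1)
    have h₂ := abs_min_sub_min_le_max (lipMinorant 1 f t) 1 (lipMinorant 1 g t) 1
    simp only [sub_self, abs_zero, abs_nonneg, sup_of_le_left] at h₁ h₂
    exact h₁.trans (h₂.trans (abs_lipMinorant_sub_le 1 f g t))
  · ext t
    have h := abs_le.1 ((f.norm_coe_le_norm t).trans hf.1)
    simp [lipMinorant_eq hf.2, h.1, h.2]

/-- There are arbitrarily small Lipschitz functions whose span is dense. -/
theorem exists_seq_lipBall {ε : ℕ → ℝ} (hε : ∀ n, 0 < ε n) :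
    ∃ x : ℕ → C(R, ℝ), (∀ n, x n ∈ lipBall R (ε n)) ∧
      Dense (Submodule.span ℝ (Set.range x) : Set C(R, ℝ)) := by
  obtain ⟨t, ht, htc, htd⟩ := (dense_lipschitz (R := R)).exists_countable_dense_subset
  obtain ⟨y, rfl⟩ := htc.exists_eq_range htd.nonempty
  choose a ha using fun n => ht (Set.mem_range_self (f := y) n)
  have ha₀ := fun n => nonneg_of_mem_lipBall (ha n)
  have hc : ∀ n, 0 < ε n / (a n + 1) := fun n => div_pos (hε n) (by linarith [ha₀ n])
  refine ⟨fun n => (ε n / (a n + 1)) • y n, fun n => lipBall_mono ?_ (smul_mem_lipBall (ha n) _),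
    htd.mono ?_⟩
  · rw [abs_of_pos (hc n), div_mul_eq_mul_div, div_le_iff₀ (by linarith [ha₀ n])]
    linarith [hε n]
  · rintro _ ⟨n, rfl⟩
    have : y n = (ε n / (a n + 1))⁻¹ • ((ε n / (a n + 1)) • y n) := by
      rw [smul_smul, inv_mul_cancel₀ (hc n).ne', one_smul]
    rw [this]
    exact Submodule.smul_mem _ _ (Submodule.subset_span ⟨n, rfl⟩)

/-- The main result for nonempty `R`: averaging an isometric copy of the `1`-Lipschitz functions
along a dense sequence of directions and differentiating at `0` gives a linear isometric embedding. -/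
theorem nonempty_linearIsometry_of_isometry {Y : Type*} [NormedAddCommGroup Y] [NormedSpace ℝ Y]
    [CompleteSpace Y] (hdiam : Metric.diam (Set.univ : Set R) ≤ 1)
    {j : {f : C(R, ℝ) | ‖f‖ ≤ 1 ∧ LipschitzWith 1 f} → Y} (hj : Isometry j) :
    Nonempty (C(R, ℝ) →ₗᵢ[ℝ] Y) := by
  obtain ⟨r, hr, hrid⟩ := exists_lipschitzWith_retraction (R := R)
  set φ : C(R, ℝ) → Y := fun f => j (r f) with hφ
  have hφlip : LipschitzWith 1 φ := by simpa [Function.comp_def] using hj.lipschitz.comp hr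
  let ε : ℕ → ℝ := fun n => 1 / 8 * 2⁻¹ ^ n
  have hε : ∀ n, 0 < ε n := fun n => by positivity
  have hsum : ∀ n, ∑ i ∈ Finset.range n, ε i ≤ 1 / 4 := fun n => by
    have : ∑ i ∈ Finset.range n, ε i = 1 / 4 - 1 / 4 * 2⁻¹ ^ n := by
      induction n with
      | zero => simp
      | succ n ih =>
        rw [Finset.sum_range_succ, ih, pow_succ]
        ring
    have h : (0 : ℝ) < 2⁻¹ ^ n := by positivity
    linarith
  obtain ⟨x, hx, hxd⟩ := exists_seq_lipBall (R := R) hε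
  obtain ⟨ψ, hψlip, hψ, hψ₂⟩ := exists_tendsto_iterAvg x
    (fun n => (ContinuousMap.norm_le _ (hε n).le).2 (hx n).2) hφlip
  let D : Submodule ℝ C(R, ℝ) :=
    { carrier := {f | (∃ C, HasSecondDiffBound ψ f C) ∧ ∃ a, f ∈ lipBall R a}
      zero_mem' := ⟨⟨0, hasSecondDiffBound_zero ψ⟩, 0, zero_mem_lipBall le_rfl⟩
      add_mem' := fun ⟨⟨_, hC⟩, _, ha⟩ ⟨⟨_, hC'⟩, _, ha'⟩ =>
        ⟨⟨_, hC.add hC'⟩, _, add_mem_lipBall ha ha'⟩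
      smul_mem' := fun c _ ⟨⟨_, hC⟩, _, ha⟩ => ⟨⟨_, hC.smul c⟩, _, smul_mem_lipBall ha c⟩ }
  have hxD : Submodule.span ℝ (Set.range x) ≤ D := by
    rw [Submodule.span_le]
    rintro _ ⟨n, rfl⟩
    exact ⟨⟨2, hψ₂ n⟩, _, hx n⟩
  have hsmall : ∀ u ∈ lipBall R (1 / 4), ‖u‖ ≤ ‖ψ u - ψ 0‖ := fun u hu => by
    refine (ContinuousMap.norm_le _ (norm_nonneg _)).2 fun z => ?_
    obtain ⟨ℓ, hℓ, c, hc⟩ := exists_functional_eq_eval hdiam hj z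
    have hℓφ : ∀ v ∈ lipBall R (1 / 2), ℓ (φ v) = v z + c := fun v hv => by
      have hvK := mem_lipBall_iff.1 (lipBall_mono (b := (1 : NNReal)) (by norm_num) hv)
      rw [hφ]
      simp only
      rw [hrid ⟨v, hvK⟩]
      exact hc ⟨v, hvK⟩ hv.2
    have hn : ∀ n, ℓ (iterAvg x n φ u) - ℓ (iterAvg x n φ 0) = u z := fun n => by
      refine iterAvg_functional_eq x ε (fun n => (hε n).le) (lipBall R) (fun a n t ht v hv => ?_)
        (fun a => zero_mem_lipBall) ℓ
        (ContinuousMap.evalCLM ℝ z : C(R, ℝ) →L[ℝ] ℝ).toLinearMap n (a := 1 / 4) (by norm_num)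
        hφlip (fun v hv => ?_) u hu
      · refine add_mem_lipBall hv (lipBall_mono ?_ (smul_mem_lipBall (hx n) t))
        rw [abs_of_nonneg ht.1]
        exact mul_le_of_le_one_left (hε n).le ht.2
      · rw [hℓφ v (lipBall_mono (by linarith [hsum n]) hv), hℓφ 0 (zero_mem_lipBall (by norm_num))]
        simp
    have hlim := ((ℓ.continuous.tendsto _).comp (hψ u)).sub ((ℓ.continuous.tendsto _).comp (hψ 0))
    have huz : u z = ℓ (ψ u - ψ 0) := by
      rw [map_sub]
      refine tendsto_nhds_unique ?_ hlim
      simp only [Function.comp_apply, hn]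
      exact tendsto_const_nhds
    rw [huz]
    exact (ℓ.le_of_opNorm_le hℓ _).trans (one_mul _).le
  refine nonempty_linearIsometry_of_secondDiffBound hψlip D (hxd.mono hxD) (fun g hg => hg.1)
    fun g hg => ?_
  obtain ⟨-, a, ha⟩ := hg
  have hev : ∀ᶠ h : ℝ in 𝓝 0, |h| * a < 1 / 4 := by
    have : Tendsto (fun h : ℝ => |h| * a) (𝓝 0) (𝓝 0) :=
      (by fun_prop : Continuous fun h : ℝ => |h| * a).tendsto' _ _ (by simp)
    exact this.eventually_lt_const (by norm_num)
  filter_upwards [hev] with h hh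
  have := hsmall (h • g) (lipBall_mono hh.le (smul_mem_lipBall ha h))
  rwa [norm_smul] at this

end ContinuousFunctions

end IsometricLinearization

/-- Let `R` be a compact metric space of diameter at most `1`, and let
`K = {f ∈ C(R) : ‖f‖∞ ≤ 1 and f is 1-Lipschitz}`. If a real Banach space `Y` contains an
isometric copy of `K`, then `C(R, ℝ)` is linearly isometric to a subspace of `Y`. -/
theorem stmt2 (R : Type*) [MetricSpace R] [CompactSpace R]
    (hdiam : Metric.diam (Set.univ : Set R) ≤ 1)
    (Y : Type*) [NormedAddCommGroup Y] [NormedSpace ℝ Y] [CompleteSpace Y]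
    (h : ∃ j : {f : C(R, ℝ) | ‖f‖ ≤ 1 ∧ LipschitzWith 1 f} → Y, Isometry j) :
    Nonempty (C(R, ℝ) →ₗᵢ[ℝ] Y) := by
  obtain ⟨j, hj⟩ := h
  rcases isEmpty_or_nonempty R with hR | hR
  · have hs : ∀ f : C(R, ℝ), f = 0 := fun f => ContinuousMap.ext fun t => hR.elim t
    exact ⟨⟨0, fun f => by simp [hs f]⟩⟩
  · exact IsometricLinearization.nonempty_linearIsometry_of_isometry hdiam hj
end

section
/- Let K₀ = {f ∈ C([0,1]) : ‖f‖∞ ≤ 1 and f is 1-Lipschitz}, a compact subset of C([0,1]). If a real Banach space Y contains an isometric copy of K₀ (i.e., there exists a distance-preserving map from K₀ into Y), then there exists a linear isometric embedding of C([0,1]) into Y. -/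
open MeasureTheory Set Filter Topology

/-- The uniform probability measure on the cube `(0, 1]^ℕ`. -/
noncomputable def cubeMeasure : Measure (ℕ → ℝ) :=
  Measure.infinitePi fun _ => volume.restrict (Ioc (0 : ℝ) 1)

instance isProbabilityMeasure_restrict_Ioc_zero_one :
    IsProbabilityMeasure (volume.restrict (Ioc (0 : ℝ) 1)) :=
  ⟨by simp⟩

instance isProbabilityMeasure_cubeMeasure : IsProbabilityMeasure cubeMeasure := by
  unfold cubeMeasure; infer_instance

/-- Resampling one coordinate preserves the uniform measure on the cube. -/
theorem measurePreserving_update_cubeMeasure (k : ℕ) :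
    MeasurePreserving (fun p : (ℕ → ℝ) × ℝ => Function.update p.1 k p.2)
      (cubeMeasure.prod (volume.restrict (Ioc (0 : ℝ) 1))) cubeMeasure := by
  have hm : Measurable (fun p : (ℕ → ℝ) × ℝ => Function.update p.1 k p.2) := by
    refine measurable_pi_lambda _ fun i => ?_
    rcases eq_or_ne i k with rfl | h
    · simpa using measurable_snd
    · simp only [Function.update_of_ne h]; fun_prop
  refine ⟨hm, Measure.eq_infinitePi _ fun s t ht => ?_⟩
  have hpre : (fun p : (ℕ → ℝ) × ℝ => Function.update p.1 k p.2) ⁻¹' (Set.pi s t) =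
      (Set.pi ((s.erase k : Finset ℕ) : Set ℕ) t) ×ˢ (if k ∈ s then t k else univ) := by
    ext ⟨ω, r⟩
    simp only [mem_preimage, Set.mem_pi, mem_prod, Finset.mem_coe, Finset.mem_erase]
    constructor
    · refine fun h => ⟨fun i hi => by simpa [hi.1] using h i hi.2, ?_⟩
      split_ifs with hk
      · simpa using h k hk
      · trivial
    · rintro ⟨h1, h2⟩ i hi
      rcases eq_or_ne i k with rfl | hik
      · simpa [hi] using h2
      · simpa [hik] using h1 i ⟨hik, hi⟩
  rw [Measure.map_apply hm (.pi s.countable_toSet fun i _ => ht i), hpre, Measure.prod_prod,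
    cubeMeasure, Measure.infinitePi_pi _ (fun i _ => ht i)]
  split_ifs with hk
  · rw [Finset.prod_erase_mul _ _ hk]
  · rw [Finset.erase_eq_of_notMem hk, measure_univ, mul_one]

theorem ae_cubeMeasure_mem : ∀ᵐ ω ∂cubeMeasure, ∀ i, ω i ∈ Ioc (0 : ℝ) 1 := by
  rw [ae_all_iff]
  intro i
  have h := measurePreserving_eval_infinitePi (fun _ : ℕ => volume.restrict (Ioc (0 : ℝ) 1)) i
  exact h.quasiMeasurePreserving.ae (ae_restrict_mem measurableSet_Ioc)

section Average

variable {Y : Type*} [NormedAddCommGroup Y] {H : (ℕ → ℝ) → Y} {L : ℕ → ℝ} {M : ℝ}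

theorem integrable_comp_of_bounded (hH : Continuous H) (hM : ∀ c, ‖H c‖ ≤ M) {Ω : Type*}
    [MeasurableSpace Ω] {μ : Measure Ω} [IsFiniteMeasure μ] {f : Ω → ℕ → ℝ} (hf : Measurable f) :
    Integrable (fun ω => H (f ω)) μ :=
  .of_bound (hH.stronglyMeasurable.comp_measurable hf).aestronglyMeasurable M
    (.of_forall fun _ => hM _)

theorem measurable_update_add (k : ℕ) (r : ℝ) (c : ℕ → ℝ) :
    Measurable fun ω : ℕ → ℝ => Function.update ω k r + c :=
  (continuous_id.update k continuous_const |>.add continuous_const).measurable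

theorem integrable_edge_sub (hH : Continuous H) (hM : ∀ c, ‖H c‖ ≤ M) (k : ℕ) (c : ℕ → ℝ) :
    Integrable (fun ω => H (Function.update ω k 1 + c) - H (Function.update ω k 0 + c))
      cubeMeasure :=
  (integrable_comp_of_bounded hH hM (measurable_update_add k 1 c)).sub
    (integrable_comp_of_bounded hH hM (measurable_update_add k 0 c))

theorem norm_apply_add_sum_single_sub_le
    (hL : ∀ c k a b, ‖H (Function.update c k a) - H (Function.update c k b)‖ ≤ L k * |a - b|)
    (S : Finset ℕ) (b c : ℕ → ℝ) :
    ‖H (c + ∑ i ∈ S, Pi.single i (b i)) - H c‖ ≤ ∑ i ∈ S, L i * |b i| := by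
  induction S using Finset.induction_on with
  | empty => simp
  | insert k S hk ih =>
    rw [Finset.sum_insert hk, Finset.sum_insert hk]
    set d := c + ∑ i ∈ S, Pi.single i (b i) with hd
    have e : c + (Pi.single k (b k) + ∑ i ∈ S, Pi.single i (b i)) =
        Function.update d k (d k + b k) := by
      ext i
      rcases eq_or_ne i k with rfl | h
      · simp [hd]; ring
      · simp [hd, h]
    have h1 := hL d k (d k + b k) (d k)
    rw [Function.update_eq_self, add_sub_cancel_left] at h1
    rw [e]
    exact (norm_sub_le_norm_sub_add_norm_sub _ (H d) _).trans (add_le_add h1 ih)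

variable [NormedSpace ℝ Y]

/-- The average of `H` over the unit cube translated by `c`. -/
noncomputable def cubeAverage (H : (ℕ → ℝ) → Y) (c : ℕ → ℝ) : Y :=
  ∫ ω, H (ω + c) ∂cubeMeasure

/-- The average increment of `H` along the `k`-th edges of the unit cube translated by `c`. It is
the derivative of `cubeAverage H` at `c` in the `k`-th direction. -/
noncomputable def edgeDifference (H : (ℕ → ℝ) → Y) (k : ℕ) (c : ℕ → ℝ) : Y :=
  ∫ ω, (H (Function.update ω k 1 + c) - H (Function.update ω k 0 + c)) ∂cubeMeasure

theorem norm_integral_shift_sub_le [CompleteSpace Y] {h : ℝ → Y} {L : ℝ} (hL : 0 ≤ L)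
    (hh : ∀ a b, ‖h a - h b‖ ≤ L * |a - b|) (s : ℝ) :
    ‖(∫ r in (0 : ℝ)..1, h (r + s)) - (∫ r in (0 : ℝ)..1, h r) - s • (h 1 - h 0)‖
      ≤ 2 * L * s ^ 2 := by
  have hc : Continuous h := by
    refine (LipschitzWith.of_dist_le_mul (K := L.toNNReal) fun a b => ?_).continuous
    simpa [dist_eq_norm, hL] using hh a b
  have hi : ∀ a b : ℝ, IntervalIntegrable h volume a b := fun a b => hc.intervalIntegrable a b
  have e1 : (∫ r in (0 : ℝ)..1, h (r + s)) - (∫ r in (0 : ℝ)..1, h r) =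
      (∫ r in (0 : ℝ)..s, h (1 + r)) - ∫ r in (0 : ℝ)..s, h r := by
    rw [intervalIntegral.integral_comp_add_right, intervalIntegral.integral_comp_add_left,
      zero_add, add_zero, ← intervalIntegral.integral_add_adjacent_intervals (hi s 1) (hi 1 (1 + s)),
      ← intervalIntegral.integral_add_adjacent_intervals (hi 0 s) (hi s 1)]
    abel
  have e2 : s • (h 1 - h 0) = ∫ _ in (0 : ℝ)..s, (h 1 - h 0) := by
    rw [intervalIntegral.integral_const, sub_zero]
  rw [e1, e2, ← intervalIntegral.integral_sub
      ((by fun_prop : Continuous fun r => h (1 + r)).intervalIntegrable _ _) (hi 0 s),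
    ← intervalIntegral.integral_sub
      ((by fun_prop : Continuous fun r => h (1 + r) - h r).intervalIntegrable _ _) (by simp)]
  refine (intervalIntegral.norm_integral_le_of_norm_le_const (C := 2 * L * |s|) fun r hr => ?_).trans
    (by rw [sub_zero, mul_assoc, ← sq, sq_abs])
  have hrs : |r| ≤ |s| := by
    rcases mem_uIoc.1 hr with h | h
    · rw [abs_of_pos h.1]; exact h.2.trans (le_abs_self s)
    · rw [abs_of_nonpos h.2, abs_of_neg (h.1.trans_le h.2)]; linarith
  calc ‖h (1 + r) - h r - (h 1 - h 0)‖ = ‖(h (1 + r) - h 1) - (h r - h 0)‖ := by congr 1; abel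
    _ ≤ ‖h (1 + r) - h 1‖ + ‖h r - h 0‖ := norm_sub_le _ _
    _ ≤ L * |1 + r - 1| + L * |r - 0| := add_le_add (hh _ _) (hh _ _)
    _ = 2 * L * |r| := by rw [add_sub_cancel_left, sub_zero]; ring
    _ ≤ 2 * L * |s| := by gcongr

theorem cubeAverage_eq (hH : Continuous H) (hM : ∀ c, ‖H c‖ ≤ M) (k : ℕ) (c : ℕ → ℝ) :
    Integrable (fun ω => ∫ r in (0 : ℝ)..1, H (Function.update ω k r + c)) cubeMeasure ∧
    cubeAverage H c = ∫ ω, (∫ r in (0 : ℝ)..1, H (Function.update ω k r + c)) ∂cubeMeasure := by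
  have hp := measurePreserving_update_cubeMeasure k
  have hi : Integrable (fun p : (ℕ → ℝ) × ℝ => H (Function.update p.1 k p.2 + c))
      (cubeMeasure.prod (volume.restrict (Ioc (0 : ℝ) 1))) :=
    integrable_comp_of_bounded hH hM (hp.measurable.add_const c)
  simp_rw [intervalIntegral.integral_of_le zero_le_one]
  refine ⟨hi.integral_prod_left, ?_⟩
  have hmap := integral_map hp.aemeasurable (f := fun ω => H (ω + c))
    (hH.comp (continuous_add_const c)).stronglyMeasurable.aestronglyMeasurable
  rw [hp.map_eq] at hmap
  rw [← integral_prod _ hi, cubeAverage, hmap]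

theorem norm_cubeAverage_add_single_sub_le [CompleteSpace Y] (hH : Continuous H)
    (hM : ∀ c, ‖H c‖ ≤ M) (hL0 : ∀ k, 0 ≤ L k)
    (hL : ∀ c k a b, ‖H (Function.update c k a) - H (Function.update c k b)‖ ≤ L k * |a - b|)
    (k : ℕ) (c : ℕ → ℝ) (s : ℝ) :
    ‖cubeAverage H (c + Pi.single k s) - cubeAverage H c - s • edgeDifference H k c‖
      ≤ 2 * L k * s ^ 2 := by
  obtain ⟨i1, e1⟩ := cubeAverage_eq hH hM k (c + Pi.single k s)
  obtain ⟨i2, e2⟩ := cubeAverage_eq hH hM k c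
  have i3 := integrable_edge_sub hH hM k c
  rw [e1, e2, edgeDifference, ← integral_smul, ← integral_sub i1 i2]
  refine (congrArg norm (integral_sub (i1.sub i2) (i3.smul s)).symm).trans_le ?_
  refine (norm_integral_le_of_norm_le_const (C := 2 * L k * s ^ 2) (.of_forall fun ω => ?_)).trans
    (by simp)
  have key : ∀ r, Function.update ω k r + (c + Pi.single k s) = Function.update ω k (r + s) + c := by
    intro r; ext i
    rcases eq_or_ne i k with rfl | h
    · simp; ring
    · simp [h]
  simp only [Pi.sub_apply, Pi.smul_apply, key]
  refine norm_integral_shift_sub_le (h := fun r => H (Function.update ω k r + c)) (hL0 k)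
    (fun a b => ?_) s
  have key2 : ∀ r, Function.update ω k r + c = Function.update (ω + c) k (r + c k) := by
    intro r; ext i
    rcases eq_or_ne i k with rfl | h
    · simp
    · simp [h]
  rw [key2, key2]
  simpa using hL (ω + c) k (a + c k) (b + c k)

theorem norm_edgeDifference_sub_le (hH : Continuous H) (hM : ∀ c, ‖H c‖ ≤ M)
    (k : ℕ) {c c' : ℕ → ℝ} {B : ℝ} (hB : ∀ ω, ‖H (ω + c) - H (ω + c')‖ ≤ B) :
    ‖edgeDifference H k c - edgeDifference H k c'‖ ≤ 2 * B := by
  rw [edgeDifference, edgeDifference, ← integral_sub (integrable_edge_sub hH hM k c)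
    (integrable_edge_sub hH hM k c')]
  refine (norm_integral_le_of_norm_le_const (C := 2 * B) (.of_forall fun ω => ?_)).trans (by simp)
  rw [sub_sub_sub_comm, two_mul]
  exact (norm_sub_le _ _).trans (add_le_add (hB _) (hB _))

/-- `cubeAverage H` has at `0` a linear derivative along finitely supported directions, with a
quadratic error bound. -/
theorem exists_norm_cubeAverage_sum_single_sub_le [CompleteSpace Y] (hH : Continuous H)
    (hM : ∀ c, ‖H c‖ ≤ M) (hL0 : ∀ k, 0 ≤ L k)
    (hL : ∀ c k a b, ‖H (Function.update c k a) - H (Function.update c k b)‖ ≤ L k * |a - b|)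
    (S : Finset ℕ) (a : ℕ → ℝ) :
    ∃ C, ∀ s : ℝ, ‖cubeAverage H (∑ i ∈ S, Pi.single i (s * a i)) - cubeAverage H 0 -
      s • ∑ i ∈ S, a i • edgeDifference H i 0‖ ≤ C * s ^ 2 := by
  induction S using Finset.induction_on with
  | empty => exact ⟨0, by simp⟩
  | insert k S hk ih =>
    obtain ⟨C, hC⟩ := ih
    refine ⟨2 * L k * a k ^ 2 + |a k| * (2 * ∑ i ∈ S, L i * |a i|) + C, fun s => ?_⟩
    rw [Finset.sum_insert hk, Finset.sum_insert hk, add_comm (Pi.single k _)]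
    set d : ℕ → ℝ := ∑ i ∈ S, Pi.single i (s * a i) with hd
    have h1 := norm_cubeAverage_add_single_sub_le hH hM hL0 hL k d (s * a k)
    have h2 : ‖edgeDifference H k d - edgeDifference H k 0‖ ≤
        2 * (|s| * ∑ i ∈ S, L i * |a i|) := by
      refine norm_edgeDifference_sub_le hH hM k fun ω => ?_
      rw [add_zero]
      refine (norm_apply_add_sum_single_sub_le hL S _ ω).trans (le_of_eq ?_)
      rw [Finset.mul_sum]
      exact Finset.sum_congr rfl fun i _ => by rw [abs_mul]; ring
    have h3 : ‖(s * a k) • (edgeDifference H k d - edgeDifference H k 0)‖ ≤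
        |a k| * (2 * ∑ i ∈ S, L i * |a i|) * s ^ 2 := by
      rw [norm_smul, Real.norm_eq_abs, abs_mul, ← sq_abs s]
      calc _ ≤ |s| * |a k| * (2 * (|s| * ∑ i ∈ S, L i * |a i|)) := by gcongr
        _ = _ := by ring
    have e : cubeAverage H (d + Pi.single k (s * a k)) - cubeAverage H 0 -
        s • (a k • edgeDifference H k 0 + ∑ i ∈ S, a i • edgeDifference H i 0) =
        (cubeAverage H (d + Pi.single k (s * a k)) - cubeAverage H d -
          (s * a k) • edgeDifference H k d) +
        (s * a k) • (edgeDifference H k d - edgeDifference H k 0) +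
        (cubeAverage H d - cubeAverage H 0 - s • ∑ i ∈ S, a i • edgeDifference H i 0) := by
      module
    rw [e]
    refine (norm_add₃_le).trans ?_
    have := hC s
    linarith

theorem norm_sum_edgeDifference_le [CompleteSpace Y] (hH : Continuous H)
    (hM : ∀ c, ‖H c‖ ≤ M) (hL0 : ∀ k, 0 ≤ L k)
    (hL : ∀ c k a b, ‖H (Function.update c k a) - H (Function.update c k b)‖ ≤ L k * |a - b|)
    (S : Finset ℕ) (a : ℕ → ℝ) {N : ℝ}
    (hN : ∀ᶠ s in 𝓝[>] (0 : ℝ),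
      ‖cubeAverage H (∑ i ∈ S, Pi.single i (s * a i)) - cubeAverage H 0‖ ≤ s * N) :
    ‖∑ i ∈ S, a i • edgeDifference H i 0‖ ≤ N := by
  obtain ⟨C, hC⟩ := exists_norm_cubeAverage_sum_single_sub_le hH hM hL0 hL S a
  have hlim : Tendsto (fun s : ℝ => N + C * s) (𝓝[>] 0) (𝓝 (N + C * 0)) :=
    (Continuous.tendsto (by fun_prop) 0).mono_left nhdsWithin_le_nhds
  rw [mul_zero, add_zero] at hlim
  refine ge_of_tendsto hlim ?_
  filter_upwards [hN, self_mem_nhdsWithin] with s h1 (hs : 0 < s)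
  have h2 := norm_le_insert (cubeAverage H (∑ i ∈ S, Pi.single i (s * a i)) - cubeAverage H 0)
    (s • ∑ i ∈ S, a i • edgeDifference H i 0)
  rw [norm_smul, Real.norm_of_nonneg hs.le] at h2
  refine le_of_mul_le_mul_left ?_ hs
  linarith [hC s]

end Average

section Lipschitz

/-- Suitably scaled monomials have geometrically small norms and Lipschitz constants, and a dense
linear span in `C([0,1])`. -/
theorem exists_lipschitz_sequence_dense :
    ∃ x : ℕ → C(Icc (0 : ℝ) 1, ℝ), (∀ i, ‖x i‖ ≤ (1 / 2 : ℝ) ^ i / 8) ∧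
      (∀ i s t, |x i s - x i t| ≤ (1 / 2 : ℝ) ^ i / 8 * |(s : ℝ) - t|) ∧
      DenseRange (Finsupp.linearCombination ℝ x) := by
  set w : ℕ → ℝ := fun i => (1 / 2 : ℝ) ^ i / 8 / (i + 1) with hw
  have hw0 : ∀ i, 0 < w i := fun i => by positivity
  have hwi : ∀ i : ℕ, w i * (i + 1) = (1 / 2 : ℝ) ^ i / 8 := fun i => by
    rw [hw]; field_simp
  set m : ℕ → C(Icc (0 : ℝ) 1, ℝ) :=
    fun i => Polynomial.toContinuousMapOn (Polynomial.X ^ i) (Icc (0 : ℝ) 1) with hm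
  have hm_apply : ∀ i t, m i t = (t : ℝ) ^ i := fun i t => by simp [hm]
  refine ⟨fun i => w i • m i, fun i => ?_, fun i s t => ?_, ?_⟩
  · rw [norm_smul, Real.norm_of_nonneg (hw0 i).le, ← hwi]
    have h1 : ‖m i‖ ≤ 1 := (ContinuousMap.norm_le _ zero_le_one).2 fun t => by
      rw [hm_apply, norm_pow, Real.norm_of_nonneg t.2.1]
      exact pow_le_one₀ t.2.1 t.2.2
    have := hw0 i
    gcongr
    exact h1.trans (by simp)
  · simp only [ContinuousMap.smul_apply, smul_eq_mul, hm_apply]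
    rw [← mul_sub, abs_mul, abs_of_pos (hw0 i), ← hwi, mul_assoc]
    have h1 : |(s : ℝ) ^ i - (t : ℝ) ^ i| ≤ |(s : ℝ) - t| * i * max |(s : ℝ)| |(t : ℝ)| ^ (i - 1) :=
      abs_pow_sub_pow_le ..
    have h2 : max |(s : ℝ)| |(t : ℝ)| ^ (i - 1) ≤ 1 := by
      refine pow_le_one₀ (le_max_of_le_left (abs_nonneg _)) (max_le ?_ ?_)
      · rw [abs_of_nonneg s.2.1]; exact s.2.2
      · rw [abs_of_nonneg t.2.1]; exact t.2.2
    refine mul_le_mul_of_nonneg_left (h1.trans ?_) (hw0 i).le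
    calc _ ≤ |(s : ℝ) - t| * i * 1 := by gcongr
      _ ≤ (i + 1) * |(s : ℝ) - t| := by linarith [abs_nonneg ((s : ℝ) - t)]
  · have hsub : (polynomialFunctions (Icc (0 : ℝ) 1) : Set C(Icc (0 : ℝ) 1, ℝ)) ⊆
        range (Finsupp.linearCombination ℝ fun i => w i • m i) := by
      rintro _ ⟨p, -, rfl⟩
      change _ ∈ LinearMap.range (Finsupp.linearCombination ℝ fun i => w i • m i)
      induction p using Polynomial.induction_on' with
      | add p q hp hq => rw [map_add]; exact add_mem hp hq
      | monomial n a =>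
        refine ⟨Finsupp.single n (a / w n), ?_⟩
        ext t
        have := (hw0 n).ne'
        simp only [Finsupp.linearCombination_single, ContinuousMap.smul_apply, smul_eq_mul,
          hm_apply]
        simp
        field_simp
    have hdense : Dense (polynomialFunctions (Icc (0 : ℝ) 1) : Set C(Icc (0 : ℝ) 1, ℝ)) :=
      fun f => continuousMap_mem_polynomialFunctions_closure 0 1 f
    exact hdense.mono hsub

variable {Y : Type*} [NormedAddCommGroup Y] [NormedSpace ℝ Y]

/-- The functional norming the difference of the images of `± (1 - |s - t|)` computes evaluation at
`t` on the part of the image coming from functions of norm at most `1 / 2`. -/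
theorem exists_dual_apply_sub_eq
    {j : {f : C(Icc (0 : ℝ) 1, ℝ) | ‖f‖ ≤ 1 ∧ LipschitzWith 1 f} → Y} (hj : Isometry j)
    (t : Icc (0 : ℝ) 1) :
    ∃ φ : StrongDual ℝ Y, ‖φ‖ ≤ 1 ∧ ∀ f g, ‖f.1‖ ≤ 1 / 2 → ‖g.1‖ ≤ 1 / 2 →
      φ (j f - j g) = f.1 t - g.1 t := by
  have hst : ∀ s : Icc (0 : ℝ) 1, |(s : ℝ) - t| ≤ 1 := fun s =>
    abs_le.2 ⟨by linarith [s.2.1, t.2.2], by linarith [s.2.2, t.2.1]⟩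
  set q : C(Icc (0 : ℝ) 1, ℝ) := ⟨fun s => 1 - |(s : ℝ) - t|, by fun_prop⟩ with hq
  have hq_apply : ∀ s, q s = 1 - |(s : ℝ) - t| := fun _ => rfl
  have hq_norm : ‖q‖ ≤ 1 := (ContinuousMap.norm_le _ zero_le_one).2 fun s => by
    rw [hq_apply, Real.norm_eq_abs, abs_le]
    constructor <;> linarith [hst s, abs_nonneg ((s : ℝ) - t)]
  have hq_lip : LipschitzWith 1 q := LipschitzWith.of_dist_le_mul fun a b => by
    rw [Real.dist_eq, hq_apply, hq_apply, Subtype.dist_eq, Real.dist_eq, sub_sub_sub_cancel_left,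
      NNReal.coe_one, one_mul]
    refine (abs_abs_sub_abs_le _ _).trans (le_of_eq ?_)
    rw [sub_sub_sub_cancel_right, abs_sub_comm]
  let p : {f : C(Icc (0 : ℝ) 1, ℝ) | ‖f‖ ≤ 1 ∧ LipschitzWith 1 f} := ⟨q, hq_norm, hq_lip⟩
  let n : {f : C(Icc (0 : ℝ) 1, ℝ) | ‖f‖ ≤ 1 ∧ LipschitzWith 1 f} :=
    ⟨-q, by rwa [norm_neg], hq_lip.neg⟩
  have hnorm : ∀ f g, ‖j f - j g‖ = ‖f.1 - g.1‖ := fun f g => by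
    rw [← dist_eq_norm, hj.dist_eq, Subtype.dist_eq, dist_eq_norm]
  obtain ⟨φ, hφ, hφ_eq⟩ := exists_dual_vector'' ℝ (j p - j n)
  have hle : ∀ y, φ y ≤ ‖y‖ := fun y =>
    (le_abs_self _).trans (by simpa using φ.le_of_opNorm_le hφ y)
  have htwo : 2 ≤ φ (j p - j n) := by
    rw [hφ_eq, hnorm]
    have := (p.1 - n.1).norm_coe_le_norm t
    rw [ContinuousMap.sub_apply] at this
    norm_num [p, n, hq_apply] at this ⊢
    exact this
  have key : ∀ f, ‖f.1‖ ≤ 1 / 2 → φ (j p - j f) = 1 - f.1 t := by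
    intro f hf
    have hb : ∀ s, |f.1 s| ≤ 1 / 2 := fun s => (f.1.norm_coe_le_norm s).trans hf
    have hlip : ∀ s, |f.1 s - f.1 t| ≤ |(s : ℝ) - t| := fun s => by
      simpa [Real.dist_eq, Subtype.dist_eq] using f.2.2.dist_le_mul s t
    have ht := abs_le.1 (hb t)
    have h1 : ‖p.1 - f.1‖ ≤ 1 - f.1 t := (ContinuousMap.norm_le _ (by linarith)).2 fun s => by
      have hs := abs_le.1 (hb s)
      have hl := abs_le.1 (hlip s)
      rw [ContinuousMap.sub_apply, Real.norm_eq_abs, abs_le]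
      change _ ≤ q s - _ ∧ q s - _ ≤ _
      rw [hq_apply]
      constructor <;> linarith [hst s]
    have h2 : ‖f.1 - n.1‖ ≤ 1 + f.1 t := (ContinuousMap.norm_le _ (by linarith)).2 fun s => by
      have hs := abs_le.1 (hb s)
      have hl := abs_le.1 (hlip s)
      rw [ContinuousMap.sub_apply, Real.norm_eq_abs, abs_le]
      change _ ≤ _ - -(q s) ∧ _ - -(q s) ≤ _
      rw [hq_apply]
      constructor <;> linarith [hst s]
    have h3 := (hle (j p - j f)).trans ((hnorm _ _).trans_le h1)
    have h4 := (hle (j f - j n)).trans ((hnorm _ _).trans_le h2)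
    have h5 : φ (j p - j n) = φ (j p - j f) + φ (j f - j n) := by rw [← map_add]; congr 1; abel
    linarith
  refine ⟨φ, hφ, fun f g hf hg => ?_⟩
  have e : j f - j g = (j p - j g) - (j p - j f) := by abel
  rw [e, map_sub, key f hf, key g hg]
  ring

end Lipschitz

section ClampedSeries

/-- The retraction of `ℝ` onto `[-2, 2]`. -/
noncomputable def clamp (a : ℝ) : ℝ := projIcc (-2 : ℝ) 2 (by norm_num) a

theorem abs_clamp_le (a : ℝ) : |clamp a| ≤ 2 := abs_le.2 (projIcc (-2 : ℝ) 2 (by norm_num) a).2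

theorem clamp_of_abs_le {a : ℝ} (ha : |a| ≤ 2) : clamp a = a := by
  rw [clamp, projIcc_of_mem _ (abs_le.1 ha)]

theorem abs_clamp_sub_clamp_le (a b : ℝ) : |clamp a - clamp b| ≤ |a - b| := by
  simpa [Real.dist_eq, Subtype.dist_eq, clamp] using
    (LipschitzWith.projIcc (show (-2 : ℝ) ≤ 2 by norm_num)).dist_le_mul a b

theorem continuous_clamp : Continuous clamp := continuous_subtype_val.comp continuous_projIcc

/-- The sum of the series `∑ cᵢ xᵢ` with coefficients truncated to `[-2, 2]`. -/
noncomputable def clampedSeries (x : ℕ → C(Icc (0 : ℝ) 1, ℝ)) (c : ℕ → ℝ) : C(Icc (0 : ℝ) 1, ℝ) :=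
  ∑' i, clamp (c i) • x i

theorem hasSum_two_mul_weight : HasSum (fun i : ℕ => 2 * ((1 / 2 : ℝ) ^ i / 8)) (1 / 2) := by
  have h := hasSum_geometric_two.mul_left (1 / 4 : ℝ)
  have e : (fun i : ℕ => 2 * ((1 / 2 : ℝ) ^ i / 8)) = fun i => 1 / 4 * (1 / 2 : ℝ) ^ i := by
    ext i; ring
  rw [e]
  norm_num at h ⊢
  exact h

variable {x : ℕ → C(Icc (0 : ℝ) 1, ℝ)}

theorem norm_clamp_smul_le (hx : ∀ i, ‖x i‖ ≤ (1 / 2 : ℝ) ^ i / 8) (i : ℕ) (a : ℝ) :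
    ‖clamp a • x i‖ ≤ 2 * ((1 / 2 : ℝ) ^ i / 8) := by
  rw [norm_smul]
  exact mul_le_mul (abs_clamp_le a) (hx i) (norm_nonneg _) zero_le_two

theorem hasSum_clampedSeries (hx : ∀ i, ‖x i‖ ≤ (1 / 2 : ℝ) ^ i / 8) (c : ℕ → ℝ) :
    HasSum (fun i => clamp (c i) • x i) (clampedSeries x c) :=
  (Summable.of_norm_bounded hasSum_two_mul_weight.summable
    fun i => norm_clamp_smul_le hx i (c i)).hasSum

theorem norm_clampedSeries_le (hx : ∀ i, ‖x i‖ ≤ (1 / 2 : ℝ) ^ i / 8) (c : ℕ → ℝ) :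
    ‖clampedSeries x c‖ ≤ 1 / 2 :=
  tsum_of_norm_bounded hasSum_two_mul_weight fun i => norm_clamp_smul_le hx i (c i)

theorem lipschitzWith_clampedSeries (hx : ∀ i, ‖x i‖ ≤ (1 / 2 : ℝ) ^ i / 8)
    (hlip : ∀ i s t, |x i s - x i t| ≤ (1 / 2 : ℝ) ^ i / 8 * |(s : ℝ) - t|) (c : ℕ → ℝ) :
    LipschitzWith 1 (clampedSeries x c) := by
  refine LipschitzWith.of_dist_le_mul fun s t => ?_
  rw [NNReal.coe_one, one_mul, Real.dist_eq, Subtype.dist_eq, Real.dist_eq]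
  have hs := fun u => ContinuousMap.hasSum_apply (hasSum_clampedSeries hx c) u
  have hd := (hs s).sub (hs t)
  rw [← hd.tsum_eq, ← Real.norm_eq_abs]
  refine (tsum_of_norm_bounded (hasSum_two_mul_weight.mul_right |(s : ℝ) - t|)
    fun i => ?_).trans (by linarith [abs_nonneg ((s : ℝ) - t)])
  rw [ContinuousMap.smul_apply, ContinuousMap.smul_apply, ← smul_sub, norm_smul, mul_assoc]
  exact mul_le_mul (abs_clamp_le _) (hlip i s t) (norm_nonneg _) zero_le_two

theorem continuous_clampedSeries (hx : ∀ i, ‖x i‖ ≤ (1 / 2 : ℝ) ^ i / 8) :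
    Continuous (clampedSeries x) :=
  continuous_tsum (fun i => (continuous_clamp.comp (continuous_apply i)).smul continuous_const)
    hasSum_two_mul_weight.summable fun i c => norm_clamp_smul_le hx i (c i)

theorem clampedSeries_sub (hx : ∀ i, ‖x i‖ ≤ (1 / 2 : ℝ) ^ i / 8) {S : Finset ℕ} {c d : ℕ → ℝ}
    (hcd : ∀ i ∉ S, c i = d i) :
    clampedSeries x c - clampedSeries x d = ∑ i ∈ S, (clamp (c i) - clamp (d i)) • x i := by
  have h := (hasSum_clampedSeries hx c).sub (hasSum_clampedSeries hx d)
  simp only [← sub_smul] at h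
  exact h.unique (hasSum_sum_of_ne_finset_zero fun i hi => by rw [hcd i hi, sub_self, zero_smul])

theorem clampedSeries_update_sub (hx : ∀ i, ‖x i‖ ≤ (1 / 2 : ℝ) ^ i / 8) (c : ℕ → ℝ) (k : ℕ)
    (a b : ℝ) :
    clampedSeries x (Function.update c k a) - clampedSeries x (Function.update c k b) =
      (clamp a - clamp b) • x k := by
  rw [clampedSeries_sub hx (S := {k}) fun i hi => ?_]
  · simp
  · have : i ≠ k := by simpa using hi
    simp [this]

theorem clampedSeries_add_sum_single_sub (hx : ∀ i, ‖x i‖ ≤ (1 / 2 : ℝ) ^ i / 8) (S : Finset ℕ)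
    {b c : ℕ → ℝ} (hc : ∀ i, |c i| ≤ 1) (hb : ∀ i ∈ S, |b i| ≤ 1) :
    clampedSeries x (c + ∑ i ∈ S, Pi.single i (b i)) - clampedSeries x c =
      ∑ i ∈ S, b i • x i := by
  have hsum : ∀ i, (∑ k ∈ S, Pi.single k (b k) : ℕ → ℝ) i = if i ∈ S then b i else 0 := fun i => by
    simp [Finset.sum_apply, Pi.single_apply]
  rw [clampedSeries_sub hx (S := S) fun i hi => ?_]
  · refine Finset.sum_congr rfl fun i hi => ?_
    rw [Pi.add_apply, hsum, if_pos hi, clamp_of_abs_le, clamp_of_abs_le, add_sub_cancel_left]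
    · linarith [hc i]
    · linarith [abs_add_le (c i) (b i), hc i, hb i hi]
  · rw [Pi.add_apply, hsum, if_neg hi, add_zero]

end ClampedSeries

/-- A linear map that preserves the seminorm pulled back along a map of dense range extends to a
linear isometry. -/
theorem nonempty_linearIsometry_of_denseRange {E X Y : Type*} [AddCommGroup E] [Module ℝ E]
    [NormedAddCommGroup X] [NormedSpace ℝ X] [NormedAddCommGroup Y] [NormedSpace ℝ Y]
    [CompleteSpace Y] {e : E →ₗ[ℝ] X} (he : DenseRange e) (f : E →ₗ[ℝ] Y)
    (hf : ∀ a, ‖f a‖ = ‖e a‖) : Nonempty (X →ₗᵢ[ℝ] Y) := by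
  refine ⟨⟨(f.extendOfNorm e : X →ₗ[ℝ] Y), fun v => ?_⟩⟩
  refine he.induction_on (p := fun v => ‖(f.extendOfNorm e : X →ₗ[ℝ] Y) v‖ = ‖v‖) v
    (isClosed_eq (f.extendOfNorm e).continuous.norm continuous_norm) fun a => ?_
  rw [ContinuousLinearMap.coe_coe, LinearMap.extendOfNorm_eq he ⟨1, fun a => by simp [hf]⟩, hf]

/-- Let `K₀ = {f ∈ C([0,1]) : ‖f‖∞ ≤ 1 and f is 1-Lipschitz}`. If a real
Banach space `Y` contains an isometric copy of `K₀`, then `C([0,1], ℝ)` is linearly isometric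
to a subspace of `Y`. -/
theorem stmt3 (Y : Type*) [NormedAddCommGroup Y] [NormedSpace ℝ Y] [CompleteSpace Y]
    (h : ∃ j : {f : C(Set.Icc (0:ℝ) 1, ℝ) | ‖f‖ ≤ 1 ∧ LipschitzWith 1 f} → Y, Isometry j) :
    Nonempty (C(Set.Icc (0:ℝ) 1, ℝ) →ₗᵢ[ℝ] Y) := by
  obtain ⟨j, hj⟩ := h
  obtain ⟨x, hx, hlip, hdense⟩ := exists_lipschitz_sequence_dense
  have hmem : ∀ c, ‖clampedSeries x c‖ ≤ 1 ∧ LipschitzWith 1 (clampedSeries x c) := fun c =>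
    ⟨(norm_clampedSeries_le hx c).trans (by norm_num), lipschitzWith_clampedSeries hx hlip c⟩
  set H : (ℕ → ℝ) → Y := fun c => j ⟨clampedSeries x c, hmem c⟩
  have hnorm : ∀ c d, ‖H c - H d‖ = ‖clampedSeries x c - clampedSeries x d‖ := fun c d => by
    rw [← dist_eq_norm, hj.dist_eq, Subtype.dist_eq, dist_eq_norm]
  have hH : Continuous H := hj.continuous.comp ((continuous_clampedSeries hx).subtype_mk _)
  have hM : ∀ c, ‖H c‖ ≤ ‖H 0‖ + 1 := fun c => by
    have h1 := norm_le_norm_add_norm_sub' (H c) (H 0)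
    have h2 := norm_sub_le (clampedSeries x c) (clampedSeries x 0)
    linarith [hnorm c 0, norm_clampedSeries_le hx c, norm_clampedSeries_le hx 0]
  have hL : ∀ c k a b, ‖H (Function.update c k a) - H (Function.update c k b)‖ ≤
      ‖x k‖ * |a - b| := fun c k a b => by
    rw [hnorm, clampedSeries_update_sub hx, norm_smul, mul_comm]
    exact mul_le_mul_of_nonneg_left (abs_clamp_sub_clamp_le a b) (norm_nonneg _)
  refine nonempty_linearIsometry_of_denseRange hdense
    (Finsupp.linearCombination ℝ fun k => edgeDifference H k 0) fun a => le_antisymm ?_ ?_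
  · rw [Finsupp.linearCombination_apply, Finsupp.linearCombination_apply]
    refine norm_sum_edgeDifference_le hH hM (fun k => norm_nonneg (x k)) hL a.support a ?_
    have hsmall : ∀ᶠ s in 𝓝[>] (0 : ℝ), ∀ i ∈ a.support, |s * a i| ≤ 1 := by
      rw [Filter.eventually_all_finset]
      intro i _
      have hcont : Tendsto (fun s : ℝ => |s * a i|) (𝓝[>] 0) (𝓝 |0 * a i|) :=
        (Continuous.tendsto (by fun_prop) 0).mono_left nhdsWithin_le_nhds
      exact (hcont.eventually_lt_const (by simp)).mono fun s hs => hs.le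
    filter_upwards [hsmall, self_mem_nhdsWithin] with s hs (hs0 : 0 < s)
    have hHint : ∀ c, Integrable (fun ω => H (ω + c)) cubeMeasure := fun c =>
      integrable_comp_of_bounded hH hM (measurable_id.add_const c)
    rw [cubeAverage, cubeAverage, ← integral_sub (hHint _) (hHint _)]
    refine (norm_integral_le_of_norm_le_const ?_).trans_eq (by rw [probReal_univ, mul_one])
    filter_upwards [ae_cubeMeasure_mem] with ω hω
    rw [hnorm, add_zero, clampedSeries_add_sum_single_sub hx _
      (fun i => by rw [abs_of_pos (hω i).1]; exact (hω i).2) hs]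
    simp_rw [mul_smul]
    rw [← Finset.smul_sum, norm_smul, Real.norm_of_nonneg hs0.le]
    rfl
  · refine (ContinuousMap.norm_le _ (norm_nonneg _)).2 fun t => ?_
    obtain ⟨φ, hφ, hφ_eq⟩ := exists_dual_apply_sub_eq hj t
    have hD : ∀ k, φ (edgeDifference H k 0) = x k t := fun k => by
      have hc : ∀ ω, φ (H (Function.update ω k 1 + 0) - H (Function.update ω k 0 + 0)) = x k t := by
        intro ω
        refine (hφ_eq ⟨_, hmem _⟩ ⟨_, hmem _⟩ (norm_clampedSeries_le hx _)
          (norm_clampedSeries_le hx _)).trans ?_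
        rw [add_zero, add_zero, ← ContinuousMap.sub_apply, clampedSeries_update_sub hx,
          clamp_of_abs_le (by norm_num : |(1 : ℝ)| ≤ 2),
          clamp_of_abs_le (by norm_num : |(0 : ℝ)| ≤ 2), sub_zero, one_smul]
      rw [edgeDifference, ← φ.integral_comp_comm (integrable_edge_sub hH hM k 0)]
      simp_rw [hc]
      simp
    have hsum : Finsupp.linearCombination ℝ x a t =
        φ (Finsupp.linearCombination ℝ (fun k => edgeDifference H k 0) a) := by
      rw [Finsupp.linearCombination_apply, Finsupp.linearCombination_apply, Finsupp.sum,
        Finsupp.sum, map_sum, ContinuousMap.sum_apply]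
      exact Finset.sum_congr rfl fun i _ => by simp [hD]
    rw [hsum]
    simpa using φ.le_of_opNorm_le hφ _
end
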